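/- arXiv:quant-ph/9611028 — 3 statements merged into one kernel-verified Lean document; each statement's English description precedes it below -/
import Mathlib

section
/- Any noisy reversible circuit of depth d and width n (n bits, all present at time 0, each bit flipped independently with probability p each time step, all gates reversible permutations of {0,1}ⁿ) satisfies: for every input, the Shannon information of the output distribution is at most (1−2p)^{2d}·n. In particular, the information about any single output bit is at most (1−2p)^{2d}·n. -/
open Finset

/-- Shannon entropy (in bits) of a probability mass function on a finite type. -/
noncomputable def shannonEnt {α : Type*} [Fintype α] (μ : α → ℝ) : ℝ :=
  ∑ x : α, -(μ x * Real.logb 2 (μ x))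

/-- Binary Shannon entropy (in bits) of a bit with `Pr[·=1] = q`. -/
noncomputable def binEnt (q : ℝ) : ℝ :=
  -(q * Real.logb 2 q) - (1 - q) * Real.logb 2 (1 - q)

/-- A noise step: each of the `n` bits is flipped independently with probability `p`. -/
noncomputable def noiseStep {n : ℕ} (p : ℝ) (μ : (Fin n → Bool) → ℝ) :
    (Fin n → Bool) → ℝ :=
  fun y => ∑ x : Fin n → Bool, μ x * ∏ i : Fin n, (if y i = x i then 1 - p else p)

/-- A reversible computation step: apply a bijection (reversible gate layer) `g` of `{0,1}ⁿ`
to the state distribution. -/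
def gateStep {n : ℕ} (g : Equiv.Perm (Fin n → Bool)) (μ : (Fin n → Bool) → ℝ) :
    (Fin n → Bool) → ℝ :=
  fun y => μ (g.symm y)

/-- Running a noisy reversible circuit of width `n`: at each time step the bits are first
hit by independent noise (flip probability `p`) and then a reversible layer is applied. -/
noncomputable def runNoisy {n : ℕ} (p : ℝ) :
    List (Equiv.Perm (Fin n → Bool)) → ((Fin n → Bool) → ℝ) → ((Fin n → Bool) → ℝ)
  | [], μ => μ
  | g :: gs, μ => runNoisy p gs (gateStep g (noiseStep p μ))

/-- The point mass at the input string `x` (all inputs present at time 0). -/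
noncomputable def pointMass {n : ℕ} (x : Fin n → Bool) : (Fin n → Bool) → ℝ :=
  fun y => if y = x then 1 else 0

open Real in
/-- The map `t ↦ (log (1 + t) - log (1 - t)) / 2 = artanh t` is star-shaped from `0` on `[0, 1)`. -/
lemma log_one_add_sub_log_one_sub_mul_le {r t : ℝ} (hr0 : 0 ≤ r) (hr1 : r ≤ 1) (ht0 : 0 ≤ t)
    (ht1 : t < 1) :
    log (1 + r * t) - log (1 - r * t) ≤ r * (log (1 + t) - log (1 - t)) := by
  have hrt : r * t ≤ t := mul_le_of_le_one_left ht0 hr1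
  have h1 := hasSum_log_sub_log_of_abs_lt_one (x := r * t)
    (by rw [abs_of_nonneg (by positivity)]; linarith)
  have h2 := (hasSum_log_sub_log_of_abs_lt_one (x := t)
    (by rwa [abs_of_nonneg ht0])).mul_left r
  refine hasSum_le (fun k => ?_) h1 h2
  have hpow : r ^ (2 * k + 1) ≤ r := pow_le_of_le_one hr0 hr1 (by omega)
  calc (2 : ℝ) * (1 / (2 * k + 1)) * (r * t) ^ (2 * k + 1)
      = r ^ (2 * k + 1) * (2 * (1 / (2 * k + 1)) * t ^ (2 * k + 1)) := by rw [mul_pow]; ring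
    _ ≤ r * (2 * (1 / (2 * k + 1)) * t ^ (2 * k + 1)) := by gcongr

open Real in
lemma hasDerivAt_binEntropy_half_sub {s t : ℝ} (h0 : 0 ≤ s * t) (h1 : s * t < 1) :
    HasDerivAt (fun t => binEntropy ((1 - s * t) / 2))
      (-(s / 2) * (log (1 + s * t) - log (1 - s * t))) t := by
  have hin : HasDerivAt (fun t : ℝ => (1 - s * t) / 2) (-(s / 2)) t := by
    have h := (((hasDerivAt_id t).const_mul s).const_sub 1).div_const 2
    rwa [mul_one, neg_div] at h
  have hb := hasDerivAt_binEntropy (p := (1 - s * t) / 2) (by linarith) (by linarith)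
  refine (hb.comp t hin).congr_deriv ?_
  have e : 1 - (1 - s * t) / 2 = (1 + s * t) / 2 := by ring
  rw [e, log_div (by linarith) two_ne_zero, log_div (by linarith) two_ne_zero]
  ring

open Real in
lemma log_two_sub_binEntropy_half_sub_le {r t : ℝ} (hr0 : 0 ≤ r) (hr1 : r ≤ 1) (ht0 : 0 ≤ t)
    (ht1 : t ≤ 1) :
    log 2 - binEntropy ((1 - r * t) / 2) ≤ r ^ 2 * (log 2 - binEntropy ((1 - t) / 2)) := by
  let φ : ℝ → ℝ := fun t => r ^ 2 * (log 2 - binEntropy ((1 - 1 * t) / 2)) -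
    (log 2 - binEntropy ((1 - r * t) / 2))
  have hderiv : ∀ u ∈ Set.Ioo (0 : ℝ) 1, HasDerivAt φ
      (r ^ 2 * -(-(1 / 2) * (log (1 + 1 * u) - log (1 - 1 * u))) -
        -(-(r / 2) * (log (1 + r * u) - log (1 - r * u)))) u := by
    rintro u ⟨hu0, hu1⟩
    have hru : r * u ≤ u := mul_le_of_le_one_left hu0.le hr1
    exact (((hasDerivAt_binEntropy_half_sub (s := 1) (by linarith) (by linarith)).const_sub
      (log 2)).const_mul (r ^ 2)).sub
      ((hasDerivAt_binEntropy_half_sub (by positivity) (by linarith)).const_sub (log 2))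
  have hmono : MonotoneOn φ (Set.Icc 0 1) := by
    refine monotoneOn_of_deriv_nonneg (convex_Icc 0 1) ?_ ?_ ?_
    · exact Continuous.continuousOn (by fun_prop)
    · rw [interior_Icc]
      exact fun u hu => (hderiv u hu).differentiableAt.differentiableWithinAt
    · rw [interior_Icc]
      intro u hu
      rw [(hderiv u hu).deriv]
      have := mul_le_mul_of_nonneg_left
        (log_one_add_sub_log_one_sub_mul_le hr0 hr1 hu.1.le hu.2) hr0
      simp only [one_mul]
      nlinarith
  have h := hmono (Set.left_mem_Icc.2 zero_le_one) ⟨ht0, ht1⟩ ht0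
  have e : ((1 : ℝ) / 2) = 2⁻¹ := by norm_num
  simp only [φ, mul_zero, sub_zero, e, binEntropy_two_inv, sub_self, one_mul] at h
  linarith

open Real in
/-- Strong data processing for the binary symmetric channel with uniform reference measure. -/
lemma log_two_sub_binEntropy_noise_le {p q : ℝ} (hp0 : 0 ≤ p) (hp1 : p ≤ 1 / 2) (hq0 : 0 ≤ q)
    (hq1 : q ≤ 1) :
    log 2 - binEntropy ((1 - p) * q + p * (1 - q)) ≤
      (1 - 2 * p) ^ 2 * (log 2 - binEntropy q) := by
  wlog hq : q ≤ 1 / 2 generalizing q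
  · have h := this (q := 1 - q) (by linarith) (by linarith) (by linarith)
    rw [binEntropy_one_sub, ← binEntropy_one_sub ((1 - p) * (1 - q) + _)] at h
    convert h using 3
    ring
  have h := log_two_sub_binEntropy_half_sub_le (r := 1 - 2 * p) (t := 1 - 2 * q)
    (by linarith) (by linarith) (by linarith) (by linarith)
  convert h using 3 <;> ring_nf

/-- The entropy deficit of a bit with unnormalized weights `a` and `b`, scaled by its mass. -/
noncomputable def bitDeficit (a b : ℝ) : ℝ :=
  (a + b) * (Real.log 2 - Real.binEntropy (a / (a + b)))

open Real in
lemma negMulLog_add_negMulLog {a b : ℝ} (ha : 0 ≤ a) (hb : 0 ≤ b) :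
    negMulLog a + negMulLog b = negMulLog (a + b) + (a + b) * log 2 - bitDeficit a b := by
  rcases (add_nonneg ha hb).eq_or_lt with h | h
  · obtain rfl : a = 0 := by linarith
    obtain rfl : b = 0 := by linarith
    simp [bitDeficit]
  · have hs : a + b ≠ 0 := h.ne'
    have h1 := negMulLog_mul (a + b) (a / (a + b))
    have h2 := negMulLog_mul (a + b) (1 - a / (a + b))
    have e1 : (a + b) * (a / (a + b)) = a := by field_simp
    have e2 : (a + b) * (1 - a / (a + b)) = b := by field_simp; ring
    rw [e1] at h1
    rw [e2] at h2
    rw [h1, h2, bitDeficit, binEntropy_eq_negMulLog_add_negMulLog_one_sub]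
    ring

lemma bitDeficit_mul (w a b : ℝ) : bitDeficit (w * a) (w * b) = w * bitDeficit a b := by
  rcases eq_or_ne w 0 with rfl | hw
  · simp [bitDeficit]
  · rw [bitDeficit, bitDeficit, ← mul_add, mul_div_mul_left _ _ hw]
    ring

lemma div_add_mem_Icc {a b : ℝ} (ha : 0 ≤ a) (hb : 0 ≤ b) : a / (a + b) ∈ Set.Icc (0 : ℝ) 1 :=
  ⟨by positivity, div_le_one_of_le₀ (by linarith) (by linarith)⟩

open Real in
lemma bitDeficit_add_le {a b c d : ℝ} (ha : 0 ≤ a) (hb : 0 ≤ b) (hc : 0 ≤ c) (hd : 0 ≤ d) :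
    bitDeficit (a + c) (b + d) ≤ bitDeficit a b + bitDeficit c d := by
  rcases (add_nonneg ha hb).eq_or_lt with h | h
  · obtain rfl : a = 0 := by linarith
    obtain rfl : b = 0 := by linarith
    simp [bitDeficit]
  rcases (add_nonneg hc hd).eq_or_lt with h' | h'
  · obtain rfl : c = 0 := by linarith
    obtain rfl : d = 0 := by linarith
    simp [bitDeficit]
  have hS : 0 < (a + b) + (c + d) := by positivity
  have key := strictConcave_binEntropy.concaveOn.2 (div_add_mem_Icc ha hb) (div_add_mem_Icc hc hd)
    (show 0 ≤ (a + b) / ((a + b) + (c + d)) by positivity)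
    (show 0 ≤ (c + d) / ((a + b) + (c + d)) by positivity) (by field_simp)
  have e : (a + b) / ((a + b) + (c + d)) * (a / (a + b)) +
      (c + d) / ((a + b) + (c + d)) * (c / (c + d)) = (a + c) / ((a + c) + (b + d)) := by
    rw [show (a + c) + (b + d) = (a + b) + (c + d) by ring]
    field_simp
  simp only [smul_eq_mul, e] at key
  have key' := mul_le_mul_of_nonneg_left key hS.le
  have e' : ((a + b) + (c + d)) * ((a + b) / ((a + b) + (c + d)) * binEntropy (a / (a + b)) +
      (c + d) / ((a + b) + (c + d)) * binEntropy (c / (c + d))) =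
      (a + b) * binEntropy (a / (a + b)) + (c + d) * binEntropy (c / (c + d)) := by
    field_simp
  rw [e'] at key'
  simp only [bitDeficit]
  linarith

lemma bitDeficit_sum_le {ι : Type*} (s : Finset ι) {w a b : ι → ℝ} (hw : ∀ i, 0 ≤ w i)
    (ha : ∀ i, 0 ≤ a i) (hb : ∀ i, 0 ≤ b i) :
    bitDeficit (∑ i ∈ s, a i * w i) (∑ i ∈ s, b i * w i) ≤
      ∑ i ∈ s, bitDeficit (a i) (b i) * w i := by
  have h := Finset.le_sum_of_subadditive_on_pred (fun x : ℝ × ℝ => bitDeficit x.1 x.2)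
    (fun x => 0 ≤ x.1 ∧ 0 ≤ x.2) (by simp [bitDeficit])
    (fun x y hx hy => bitDeficit_add_le hx.1 hx.2 hy.1 hy.2)
    (fun x y hx hy => ⟨add_nonneg hx.1 hy.1, add_nonneg hx.2 hy.2⟩)
    (fun i => (w i * a i, w i * b i)) (s := s)
    (fun i _ => ⟨mul_nonneg (hw i) (ha i), mul_nonneg (hw i) (hb i)⟩)
  simp only [Prod.fst_sum, Prod.snd_sum, bitDeficit_mul] at h
  simpa only [mul_comm (w _)] using h

lemma bitDeficit_noise_le {p a b : ℝ} (hp0 : 0 ≤ p) (hp1 : p ≤ 1 / 2) (ha : 0 ≤ a)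
    (hb : 0 ≤ b) :
    bitDeficit ((1 - p) * a + p * b) ((1 - p) * b + p * a) ≤
      (1 - 2 * p) ^ 2 * bitDeficit a b := by
  rcases (add_nonneg ha hb).eq_or_lt with h | h
  · obtain rfl : a = 0 := by linarith
    obtain rfl : b = 0 := by linarith
    simp [bitDeficit]
  have hq := div_add_mem_Icc ha hb
  have key := mul_le_mul_of_nonneg_left
    (log_two_sub_binEntropy_noise_le hp0 hp1 hq.1 hq.2) h.le
  have e : (1 - p) * (a / (a + b)) + p * (1 - a / (a + b)) =
      ((1 - p) * a + p * b) / (a + b) := by field_simp; ring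
  rw [e] at key
  have es : (1 - p) * a + p * b + ((1 - p) * b + p * a) = a + b := by ring
  rw [bitDeficit, bitDeficit, es]
  linarith

lemma sum_fin_succ_bool {n : ℕ} (F : (Fin (n + 1) → Bool) → ℝ) :
    ∑ x, F x = ∑ z : Fin n → Bool,
      (F (Fin.cons (α := fun _ => Bool) true z) + F (Fin.cons (α := fun _ => Bool) false z)) := by
  rw [← (Fin.consEquiv (fun _ : Fin (n + 1) => Bool)).sum_comp, Fintype.sum_prod_type,
    Fintype.sum_bool, ← Finset.sum_add_distrib]
  rfl

lemma sum_noise_kernel {n : ℕ} (p : ℝ) (x : Fin n → Bool) :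
    ∑ y : Fin n → Bool, ∏ i, (if y i = x i then 1 - p else p) = 1 := by
  rw [← Fintype.prod_sum (fun i (b : Bool) => if b = x i then 1 - p else p)]
  refine Finset.prod_eq_one fun i _ => ?_
  cases x i <;> simp

lemma noise_kernel_nonneg {n : ℕ} {p : ℝ} (hp0 : 0 ≤ p) (hp1 : p ≤ 1) (x y : Fin n → Bool) :
    0 ≤ ∏ i, (if y i = x i then 1 - p else p) :=
  Finset.prod_nonneg fun i _ => by split_ifs <;> linarith

lemma noiseStep_nonneg {n : ℕ} {p : ℝ} (hp0 : 0 ≤ p) (hp1 : p ≤ 1) {μ : (Fin n → Bool) → ℝ}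
    (hμ : ∀ x, 0 ≤ μ x) (y : Fin n → Bool) : 0 ≤ noiseStep p μ y :=
  Finset.sum_nonneg fun x _ => mul_nonneg (hμ x) (noise_kernel_nonneg hp0 hp1 x y)

lemma sum_noiseStep {n : ℕ} (p : ℝ) (μ : (Fin n → Bool) → ℝ) :
    ∑ y, noiseStep p μ y = ∑ x, μ x := by
  simp only [noiseStep]
  rw [Finset.sum_comm]
  simp only [← Finset.mul_sum, sum_noise_kernel, mul_one]

lemma noiseStep_add {n : ℕ} (p : ℝ) (μ ν : (Fin n → Bool) → ℝ) (y : Fin n → Bool) :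
    noiseStep p (fun x => μ x + ν x) y = noiseStep p μ y + noiseStep p ν y := by
  simp only [noiseStep, add_mul, Finset.sum_add_distrib]

lemma noiseStep_cons {n : ℕ} (p : ℝ) (μ : (Fin (n + 1) → Bool) → ℝ) (b : Bool)
    (y : Fin n → Bool) :
    noiseStep p μ (Fin.cons (α := fun _ => Bool) b y) =
      (1 - p) * noiseStep p (fun z => μ (Fin.cons (α := fun _ => Bool) b z)) y +
        p * noiseStep p (fun z => μ (Fin.cons (α := fun _ => Bool) (!b) z)) y := by
  simp only [noiseStep]
  rw [sum_fin_succ_bool, Finset.mul_sum, Finset.mul_sum, ← Finset.sum_add_distrib]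
  refine Finset.sum_congr rfl fun z _ => ?_
  cases b <;> simp [Fin.prod_univ_succ] <;> ring

lemma sum_bitDeficit_noiseStep_le {n : ℕ} {p : ℝ} (hp0 : 0 ≤ p) (hp1 : p ≤ 1)
    {μ ν : (Fin n → Bool) → ℝ} (hμ : ∀ x, 0 ≤ μ x) (hν : ∀ x, 0 ≤ ν x) :
    ∑ y, bitDeficit (noiseStep p μ y) (noiseStep p ν y) ≤ ∑ x, bitDeficit (μ x) (ν x) :=
  calc ∑ y, bitDeficit (noiseStep p μ y) (noiseStep p ν y)
      ≤ ∑ y, noiseStep p (fun x => bitDeficit (μ x) (ν x)) y :=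
        Finset.sum_le_sum fun y _ =>
          bitDeficit_sum_le _ (fun x => noise_kernel_nonneg hp0 hp1 x y) hμ hν
    _ = _ := sum_noiseStep _ _

open Real in
lemma sum_negMulLog_fin_succ {n : ℕ} {μ : (Fin (n + 1) → Bool) → ℝ} (hμ : ∀ x, 0 ≤ μ x) :
    ∑ x, negMulLog (μ x) =
      ∑ z : Fin n → Bool, negMulLog (μ (Fin.cons (α := fun _ => Bool) true z) +
        μ (Fin.cons (α := fun _ => Bool) false z)) + (∑ x, μ x) * log 2 -
      ∑ z : Fin n → Bool, bitDeficit (μ (Fin.cons (α := fun _ => Bool) true z))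
        (μ (Fin.cons (α := fun _ => Bool) false z)) := by
  rw [sum_fin_succ_bool, sum_fin_succ_bool, Finset.sum_mul, ← Finset.sum_add_distrib,
    ← Finset.sum_sub_distrib]
  exact Finset.sum_congr rfl fun z _ => negMulLog_add_negMulLog (hμ _) (hμ _)

open Real in
/-- A noise step contracts the information `n log 2 - H` by the factor `(1 - 2p)²`. -/
lemma info_noiseStep_le {n : ℕ} {p : ℝ} (hp0 : 0 ≤ p) (hp1 : p ≤ 1 / 2)
    {μ : (Fin n → Bool) → ℝ} (hμ : ∀ x, 0 ≤ μ x) (hsum : ∑ x, μ x = 1) :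
    n * log 2 - ∑ y, negMulLog (noiseStep p μ y) ≤
      (1 - 2 * p) ^ 2 * (n * log 2 - ∑ x, negMulLog (μ x)) := by
  induction n with
  | zero =>
    rw [Fintype.sum_unique] at hsum
    simp only [noiseStep, Fintype.sum_unique, hsum]
    simp
  | succ n ih =>
    set μ₁ : (Fin n → Bool) → ℝ := fun z => μ (Fin.cons (α := fun _ => Bool) true z) with h₁
    set μ₀ : (Fin n → Bool) → ℝ := fun z => μ (Fin.cons (α := fun _ => Bool) false z) with h₀
    have hp1' : p ≤ 1 := by linarith
    have hμ₁ : ∀ z, 0 ≤ μ₁ z := fun z => hμ _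
    have hμ₀ : ∀ z, 0 ≤ μ₀ z := fun z => hμ _
    have hmarg := ih (μ := fun z => μ₁ z + μ₀ z) (fun z => add_nonneg (hμ₁ z) (hμ₀ z))
      (by rw [← hsum, sum_fin_succ_bool])
    rw [sum_negMulLog_fin_succ hμ, sum_negMulLog_fin_succ (noiseStep_nonneg hp0 hp1' hμ),
      sum_noiseStep, hsum]
    simp only [noiseStep_cons, Bool.not_true, Bool.not_false, ← h₁, ← h₀]
    have hcond : ∑ z, bitDeficit ((1 - p) * noiseStep p μ₁ z + p * noiseStep p μ₀ z)
        ((1 - p) * noiseStep p μ₀ z + p * noiseStep p μ₁ z) ≤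
        (1 - 2 * p) ^ 2 * ∑ z, bitDeficit (μ₁ z) (μ₀ z) :=
      calc _ ≤ ∑ z, (1 - 2 * p) ^ 2 * bitDeficit (noiseStep p μ₁ z) (noiseStep p μ₀ z) :=
            Finset.sum_le_sum fun z _ => bitDeficit_noise_le hp0 hp1
              (noiseStep_nonneg hp0 hp1' hμ₁ z) (noiseStep_nonneg hp0 hp1' hμ₀ z)
        _ ≤ _ := by
            rw [← Finset.mul_sum]
            exact mul_le_mul_of_nonneg_left (sum_bitDeficit_noiseStep_le hp0 hp1' hμ₁ hμ₀)
              (sq_nonneg _)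
    have hm : ∀ z, (1 - p) * noiseStep p μ₁ z + p * noiseStep p μ₀ z +
        ((1 - p) * noiseStep p μ₀ z + p * noiseStep p μ₁ z) =
        noiseStep p (fun z => μ₁ z + μ₀ z) z := fun z => by rw [noiseStep_add]; ring
    simp only [hm]
    push_cast
    linarith

lemma runNoisy_nonneg {n : ℕ} {p : ℝ} (hp0 : 0 ≤ p) (hp1 : p ≤ 1)
    (gates : List (Equiv.Perm (Fin n → Bool))) {μ : (Fin n → Bool) → ℝ} (hμ : ∀ x, 0 ≤ μ x)
    (y : Fin n → Bool) : 0 ≤ runNoisy p gates μ y := by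
  induction gates generalizing μ with
  | nil => exact hμ y
  | cons g gs ih => exact ih fun x => noiseStep_nonneg hp0 hp1 hμ _

lemma sum_runNoisy {n : ℕ} (p : ℝ) (gates : List (Equiv.Perm (Fin n → Bool)))
    (μ : (Fin n → Bool) → ℝ) : ∑ y, runNoisy p gates μ y = ∑ x, μ x := by
  induction gates generalizing μ with
  | nil => rfl
  | cons g gs ih =>
    rw [runNoisy, ih, ← sum_noiseStep p μ]
    exact g.symm.sum_comp (noiseStep p μ)

open Real in
lemma info_runNoisy_le {n : ℕ} {p : ℝ} (hp0 : 0 ≤ p) (hp1 : p ≤ 1 / 2)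
    (gates : List (Equiv.Perm (Fin n → Bool))) {μ : (Fin n → Bool) → ℝ} (hμ : ∀ x, 0 ≤ μ x)
    (hsum : ∑ x, μ x = 1) :
    n * log 2 - ∑ y, negMulLog (runNoisy p gates μ y) ≤
      (1 - 2 * p) ^ (2 * gates.length) * (n * log 2 - ∑ x, negMulLog (μ x)) := by
  induction gates generalizing μ with
  | nil => simp [runNoisy]
  | cons g gs ih =>
    have hgate : ∀ F : ℝ → ℝ, ∑ x, F (gateStep g (noiseStep p μ) x) =
        ∑ x, F (noiseStep p μ x) := fun F => g.symm.sum_comp fun x => F (noiseStep p μ x)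
    have h := ih (μ := gateStep g (noiseStep p μ))
      (fun x => noiseStep_nonneg hp0 (by linarith) hμ _)
      ((hgate id).trans ((sum_noiseStep p μ).trans hsum))
    rw [hgate negMulLog] at h
    have hpow : 0 ≤ (1 - 2 * p) ^ (2 * gs.length) := by rw [pow_mul]; positivity
    refine h.trans
      ((mul_le_mul_of_nonneg_left (info_noiseStep_le hp0 hp1 hμ hsum) hpow).trans_eq ?_)
    rw [List.length_cons, mul_add, pow_add]
    ring

open Real in
lemma shannonEnt_eq_sum_negMulLog {α : Type*} [Fintype α] (μ : α → ℝ) :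
    shannonEnt μ = (∑ x, negMulLog (μ x)) / log 2 := by
  rw [shannonEnt, Finset.sum_div]
  exact Finset.sum_congr rfl fun x _ => by rw [negMulLog, logb]; ring

open Real in
lemma binEnt_eq_binEntropy (q : ℝ) : binEnt q = binEntropy q / log 2 := by
  rw [binEnt, binEntropy_eq_negMulLog_add_negMulLog_one_sub, negMulLog, negMulLog, logb, logb]
  ring

open Real in
lemma sum_negMulLog_le {ι : Type*} {s : Finset ι} (hs : s.Nonempty) {μ : ι → ℝ}
    (hμ : ∀ x, 0 ≤ μ x) :
    ∑ x ∈ s, negMulLog (μ x) ≤ negMulLog (∑ x ∈ s, μ x) + (∑ x ∈ s, μ x) * log s.card := by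
  have hc : (0 : ℝ) < s.card := by exact_mod_cast hs.card_pos
  have key := concaveOn_negMulLog.le_map_sum (t := s) (w := fun _ => (s.card : ℝ)⁻¹) (p := μ)
    (fun _ _ => by positivity) (by simp [hc.ne']) (fun x _ => hμ x)
  simp only [smul_eq_mul, ← Finset.mul_sum] at key
  rw [negMulLog_mul] at key
  have key' := mul_le_mul_of_nonneg_left key hc.le
  rw [mul_inv_cancel_left₀ hc.ne'] at key'
  refine key'.trans_eq ?_
  rw [show negMulLog (s.card : ℝ)⁻¹ = (s.card : ℝ)⁻¹ * log s.card by
    rw [negMulLog, log_inv]; ring]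
  field_simp
  ring

lemma card_filter_apply_eq {n : ℕ} (i : Fin n) (b : Bool) :
    (univ.filter fun y : Fin n → Bool => y i = b).card = 2 ^ (n - 1) := by
  have h := Fintype.card_filter_piFinset_const_eq_of_mem (univ : Finset Bool) i (mem_univ b)
  rwa [Fintype.piFinset_univ, Finset.card_univ, Fintype.card_bool, Fintype.card_fin] at h

open Real in
/-- The information about a single bit is at most the information of the whole string. -/
lemma bit_info_le {n : ℕ} {μ : (Fin n → Bool) → ℝ} (hμ : ∀ x, 0 ≤ μ x) (hsum : ∑ x, μ x = 1)
    (i : Fin n) :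
    log 2 - binEntropy (∑ y ∈ univ.filter (fun y : Fin n → Bool => y i = true), μ y) ≤
      n * log 2 - ∑ x, negMulLog (μ x) := by
  have hbound : ∀ b : Bool, ∑ y ∈ univ.filter (fun y : Fin n → Bool => y i = b), negMulLog (μ y) ≤
      negMulLog (∑ y ∈ univ.filter (fun y : Fin n → Bool => y i = b), μ y) +
        (∑ y ∈ univ.filter (fun y : Fin n → Bool => y i = b), μ y) * ((n - 1) * log 2) := by
    intro b
    have h := sum_negMulLog_le (s := univ.filter fun y : Fin n → Bool => y i = b)
      ⟨fun _ => b, by simp⟩ hμ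
    rwa [card_filter_apply_eq, Nat.cast_pow, log_pow, Nat.cast_sub (by have := i.2; omega),
      Nat.cast_one, Nat.cast_ofNat] at h
  have hsplit : ∀ F : (Fin n → Bool) → ℝ, ∑ y, F y =
      ∑ y ∈ univ.filter (fun y : Fin n → Bool => y i = true), F y +
        ∑ y ∈ univ.filter (fun y : Fin n → Bool => y i = false), F y := fun F => by
    simpa using (Finset.sum_filter_add_sum_filter_not univ
      (fun y : Fin n → Bool => y i = true) F).symm
  have h1 := hbound true
  have h0 := hbound false
  rw [hsplit] at hsum
  rw [eq_sub_of_add_eq' hsum] at h0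
  rw [hsplit, binEntropy_eq_negMulLog_add_negMulLog_one_sub]
  linarith

/-- Any noisy reversible circuit of depth `d` and width `n` satisfies: for every input, the
Shannon information of the output distribution is at most `(1−2p)^{2d}·n`; in particular the
information about any single output bit is at most `(1−2p)^{2d}·n`. -/
theorem noisy_reversible_info_decay {n : ℕ} (p : ℝ) (hp0 : 0 < p) (hp1 : p < 1 / 2)
    (gates : List (Equiv.Perm (Fin n → Bool))) (x : Fin n → Bool) :
    ((n : ℝ) - shannonEnt (runNoisy p gates (pointMass x)) ≤
        (1 - 2 * p) ^ (2 * gates.length) * n) ∧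
      (∀ i : Fin n,
        1 - binEnt (∑ y ∈ univ.filter (fun y : Fin n → Bool => y i = true),
            runNoisy p gates (pointMass x) y) ≤
          (1 - 2 * p) ^ (2 * gates.length) * n) := by
  have hlog : 0 < Real.log 2 := Real.log_pos one_lt_two
  have hμ : ∀ y, 0 ≤ pointMass x y := fun y => by
    unfold pointMass; split_ifs <;> norm_num
  have hsum : ∑ y, pointMass x y = 1 := by simp [pointMass]
  have hent : ∑ y, Real.negMulLog (pointMass x y) = 0 :=
    Finset.sum_eq_zero fun y _ => by unfold pointMass; split_ifs <;> simp
  have hinfo := info_runNoisy_le hp0.le hp1.le gates hμ hsum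
  rw [hent, sub_zero, ← mul_assoc] at hinfo
  refine ⟨?_, fun i => ?_⟩
  · rw [shannonEnt_eq_sum_negMulLog]
    refine le_of_mul_le_mul_right ?_ hlog
    rwa [sub_mul, div_mul_cancel₀ _ hlog.ne']
  · have hbit := bit_info_le (runNoisy_nonneg hp0.le (by linarith) gates hμ)
      ((sum_runNoisy p gates _).trans hsum) i
    rw [binEnt_eq_binEntropy]
    refine le_of_mul_le_mul_right ?_ hlog
    rw [sub_mul, div_mul_cancel₀ _ hlog.ne', one_mul]
    exact hbit.trans hinfo
end

section
/- (Averaged subsystem information bound) Let ρ be a density matrix of n qubits and 0 < k < n. Then (1/C(n,k))·∑_{A : |A|=k} I(ρ|_A) ≤ (k/n)·I(ρ), where the sum is over all k-element subsets A of the qubits, ρ|_A is the reduced density matrix on A, I(σ) = m − S(σ) for a density matrix σ on m qubits, and C(n,k) is the binomial coefficient. -/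
open Matrix ComplexOrder

/-- A density matrix: positive semidefinite with trace 1. -/
def IsDensityMatrix {n : Type*} [Fintype n] (ρ : Matrix n n ℂ) : Prop :=
  ρ.PosSemidef ∧ ρ.trace = 1

/-- The base-2 matrix logarithm of a Hermitian matrix, defined through its spectral
decomposition, with the convention `log₂ 0 = 0` on the kernel. -/
noncomputable def matLog2 {n : Type*} [Fintype n] [DecidableEq n] {A : Matrix n n ℂ}
    (hA : A.IsHermitian) : Matrix n n ℂ :=
  (hA.eigenvectorUnitary : Matrix n n ℂ) *
    diagonal (fun i => (Real.logb 2 (hA.eigenvalues i) : ℂ)) *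
    star (hA.eigenvectorUnitary : Matrix n n ℂ)

/-- The von Neumann entropy (in bits) `S(ρ) = −Tr(ρ log₂ ρ)` of a Hermitian matrix. -/
noncomputable def vnEntropy {n : Type*} [Fintype n] [DecidableEq n] {A : Matrix n n ℂ}
    (hA : A.IsHermitian) : ℝ :=
  (-(A * matLog2 hA).trace).re

open Finset

/-- Combine an assignment on the qubits in `s` with one on the qubits outside `s`. -/
def combineBits {n : ℕ} (s : Finset (Fin n)) (f : {i : Fin n // i ∈ s} → Bool)
    (g : {i : Fin n // i ∉ s} → Bool) : Fin n → Bool :=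
  fun i => if h : i ∈ s then f ⟨i, h⟩ else g ⟨i, h⟩

/-- Reduced density matrix of an `n`-qubit state on the subset `s` of the qubits
(partial trace over the qubits outside `s`). -/
noncomputable def reduceTo {n : ℕ} (ρ : Matrix (Fin n → Bool) (Fin n → Bool) ℂ)
    (s : Finset (Fin n)) :
    Matrix ({i : Fin n // i ∈ s} → Bool) ({i : Fin n // i ∈ s} → Bool) ℂ :=
  Matrix.of fun f f' => ∑ g : {i : Fin n // i ∉ s} → Bool,
    ρ (combineBits s f g) (combineBits s f' g)

/-- If `t ↦ ∑ p log (l + t)` grows faster than `t ↦ ∑ q log (m + t)` and both have the same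
total weight, then comparing them at infinity orders them at `t = 0`. -/
theorem sum_mul_log_le_of_sum_div_le {ι κ : Type*} [Fintype ι] [Fintype κ]
    {p l : ι → ℝ} {q m : κ → ℝ} (hl : ∀ i, 0 ≤ l i) (hm : ∀ j, 0 ≤ m j)
    (hpl : ∀ i, p i ≠ 0 → l i ≠ 0) (hqm : ∀ j, q j ≠ 0 → m j ≠ 0)
    (hpq : ∑ i, p i = ∑ j, q j)
    (h : ∀ t : ℝ, 0 < t → ∑ j, q j / (m j + t) ≤ ∑ i, p i / (l i + t)) :
    ∑ i, p i * Real.log (l i) ≤ ∑ j, q j * Real.log (m j) := by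
  have hcont {x c : ℝ} (hx : 0 ≤ x) (hc : c ≠ 0 → x ≠ 0) :
      ContinuousOn (fun t => c * Real.log (x + t)) (Set.Ici 0) := by
    by_cases hc0 : c = 0
    · simpa [hc0] using continuousOn_const
    · have hx0 : 0 < x := lt_of_le_of_ne hx (hc hc0).symm
      refine continuousOn_const.mul (ContinuousOn.log (by fun_prop) ?_)
      intro t ht
      have : (0 : ℝ) ≤ t := ht
      positivity
  have hderiv {x c t : ℝ} (hx : 0 ≤ x) (ht : 0 < t) :
      HasDerivAt (fun t => c * Real.log (x + t)) (c / (x + t)) t := by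
    have h1 : HasDerivAt (fun t => x + t) 1 t := (hasDerivAt_id t).const_add x
    simpa [div_eq_mul_inv] using (h1.log (by positivity)).const_mul c
  have hlim {x c : ℝ} :
      Filter.Tendsto (fun t => c * Real.log (x + t) - c * Real.log t) Filter.atTop (nhds 0) := by
    have h1 : Filter.Tendsto (fun t : ℝ => x / t + 1) Filter.atTop (nhds (0 + 1)) :=
      (Filter.tendsto_id.const_div_atTop x).add_const 1
    have h2 := (h1.log (by norm_num)).const_mul c
    simp only [zero_add, Real.log_one, mul_zero] at h2
    refine h2.congr' ?_
    filter_upwards [Filter.eventually_gt_atTop (max 0 (-x))] with t ht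
    have ht0 : 0 < t := (le_max_left _ _).trans_lt ht
    have htx : 0 < x + t := by linarith [(le_max_right 0 (-x)).trans_lt ht]
    rw [← mul_sub, ← Real.log_div htx.ne' ht0.ne', add_div, div_self ht0.ne']
  set F : ℝ → ℝ := fun t =>
    ∑ i, p i * Real.log (l i + t) - ∑ j, q j * Real.log (m j + t) with hF
  have hFderiv (t : ℝ) (ht : 0 < t) :
      HasDerivAt F (∑ i, p i / (l i + t) - ∑ j, q j / (m j + t)) t :=
    (HasDerivAt.fun_sum fun i _ => hderiv (hl i) ht).sub
      (HasDerivAt.fun_sum fun j _ => hderiv (hm j) ht)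
  have hmono : MonotoneOn F (Set.Ici 0) := by
    refine monotoneOn_of_deriv_nonneg (convex_Ici 0) ?_ ?_ ?_
    · exact (continuousOn_finsetSum _ fun i _ => hcont (hl i) (hpl i)).sub
        (continuousOn_finsetSum _ fun j _ => hcont (hm j) (hqm j))
    · rw [interior_Ici]
      exact fun t ht => (hFderiv t ht).differentiableAt.differentiableWithinAt
    · rw [interior_Ici]
      intro t ht
      rw [(hFderiv t ht).deriv]
      exact sub_nonneg.2 (h t ht)
  have hFlim : Filter.Tendsto F Filter.atTop (nhds 0) := by
    have h1 := (tendsto_finsetSum univ fun i (_ : i ∈ univ) => hlim (x := l i) (c := p i)).sub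
      (tendsto_finsetSum univ fun j (_ : j ∈ univ) => hlim (x := m j) (c := q j))
    simp only [sum_const_zero, sub_zero] at h1
    refine h1.congr fun t => ?_
    simp only [hF, sum_sub_distrib, ← sum_mul, hpq]
    ring
  have h0 : F 0 ≤ 0 := by
    refine ge_of_tendsto hFlim ?_
    filter_upwards [Filter.eventually_ge_atTop 0] with t ht
    exact hmono Set.self_mem_Ici ht ht
  simpa [hF] using h0

theorem trace_conjTranspose_mul_eq {N : Type*} [Fintype N] (x y : Matrix N N ℂ) :
    (xᴴ * y).trace = ∑ i, ∑ j, star (x i j) * y i j := by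
  simp only [trace, diag_apply, mul_apply, conjTranspose_apply]
  exact sum_comm

/-- A variational functional whose maximum over `X` is the resolvent expectation of the
relative modular operator of `ρ` and `σ`. -/
noncomputable def resolventFunctional {N : Type*} [Fintype N] (ρ σ : Matrix N N ℂ) (t : ℝ)
    (X : Matrix N N ℂ) : ℝ :=
  2 * (Xᴴ * ρ).trace.re - (X * Xᴴ * σ).trace.re - t * (Xᴴ * X * ρ).trace.re

section Resolvent

variable {N : Type*} [Fintype N] [DecidableEq N] {U V : Matrix N N ℂ} {r s : N → ℝ}

theorem resolventFunctional_conj (hU : Uᴴ * U = 1) (hV : Vᴴ * V = 1) (t : ℝ)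
    (x : Matrix N N ℂ) :
    resolventFunctional (U * diagonal (fun i => (r i : ℂ)) * Uᴴ)
        (V * diagonal (fun i => (s i : ℂ)) * Vᴴ) t (V * x * Uᴴ) =
      ∑ i, ∑ j, (2 * r j * (star (x i j) * (Vᴴ * U) i j).re -
        (s i + t * r j) * Complex.normSq (x i j)) := by
  have h1 : ((V * x * Uᴴ)ᴴ * (U * diagonal (fun i => (r i : ℂ)) * Uᴴ)).trace =
      (xᴴ * ((Vᴴ * U) * diagonal (fun i => (r i : ℂ)))).trace := by
    simp only [conjTranspose_mul, conjTranspose_conjTranspose, Matrix.mul_assoc]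
    rw [trace_mul_comm]
    simp only [Matrix.mul_assoc, hU, Matrix.mul_one]
  have h2 : ((V * x * Uᴴ) * (V * x * Uᴴ)ᴴ * (V * diagonal (fun i => (s i : ℂ)) * Vᴴ)).trace =
      (xᴴ * (diagonal (fun i => (s i : ℂ)) * x)).trace := by
    have e : (V * x * Uᴴ) * (V * x * Uᴴ)ᴴ * (V * diagonal (fun i => (s i : ℂ)) * Vᴴ) =
        (V * x) * ((Uᴴ * U) * xᴴ * (Vᴴ * V) * diagonal (fun i => (s i : ℂ)) * Vᴴ) := by
      simp only [conjTranspose_mul, conjTranspose_conjTranspose, Matrix.mul_assoc]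
    rw [e, hU, hV, trace_mul_comm]
    have e' : 1 * xᴴ * 1 * diagonal (fun i => (s i : ℂ)) * Vᴴ * (V * x) =
        xᴴ * diagonal (fun i => (s i : ℂ)) * (Vᴴ * V) * x := by
      simp only [Matrix.mul_assoc, Matrix.one_mul]
    rw [e', hV]
    simp only [Matrix.mul_assoc, Matrix.one_mul]
  have h3 : ((V * x * Uᴴ)ᴴ * (V * x * Uᴴ) * (U * diagonal (fun i => (r i : ℂ)) * Uᴴ)).trace =
      (xᴴ * (x * diagonal (fun i => (r i : ℂ)))).trace := by
    have e : (V * x * Uᴴ)ᴴ * (V * x * Uᴴ) * (U * diagonal (fun i => (r i : ℂ)) * Uᴴ) =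
        U * (xᴴ * (Vᴴ * V) * x * (Uᴴ * U) * diagonal (fun i => (r i : ℂ)) * Uᴴ) := by
      simp only [conjTranspose_mul, conjTranspose_conjTranspose, Matrix.mul_assoc]
    rw [e, hU, hV, trace_mul_comm]
    simp only [Matrix.mul_assoc, hU, Matrix.mul_one]
  simp only [resolventFunctional, h1, h2, h3, trace_conjTranspose_mul_eq, mul_diagonal,
    diagonal_mul, Complex.re_sum, mul_sum, ← sum_sub_distrib]
  refine sum_congr rfl fun i _ => sum_congr rfl fun j _ => ?_
  simp [Complex.normSq_apply]
  ring

theorem resolventFunctional_le (hU : Uᴴ * U = 1) (hV : Vᴴ * V = 1)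
    (hr : ∀ i, 0 ≤ r i) (hs : ∀ i, 0 ≤ s i) {t : ℝ} (ht : 0 < t) (X : Matrix N N ℂ) :
    resolventFunctional (U * diagonal (fun i => (r i : ℂ)) * Uᴴ)
        (V * diagonal (fun i => (s i : ℂ)) * Vᴴ) t X ≤
      ∑ i, ∑ j, r j * Complex.normSq ((Vᴴ * U) i j) / (s i / r j + t) := by
  have hX : X = V * (Vᴴ * X * U) * Uᴴ := by
    have e : V * (Vᴴ * X * U) * Uᴴ = (V * Vᴴ) * X * (U * Uᴴ) := by
      simp only [Matrix.mul_assoc]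
    rw [e, mul_eq_one_comm.1 hU, mul_eq_one_comm.1 hV, Matrix.one_mul, Matrix.mul_one]
  rw [hX, resolventFunctional_conj hU hV]
  refine sum_le_sum fun i _ => sum_le_sum fun j _ => ?_
  generalize (Vᴴ * X * U) i j = x
  generalize (Vᴴ * U) i j = w
  rcases (hr j).eq_or_lt with h0 | h0
  · have := mul_nonneg (hs i) (Complex.normSq_nonneg x)
    simp [← h0]
    exact this
  · have hd : 0 < s i + t * r j := add_pos_of_nonneg_of_pos (hs i) (by positivity)
    have e : r j * Complex.normSq w / (s i / r j + t) =
        r j ^ 2 * Complex.normSq w / (s i + t * r j) := by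
      field_simp
    rw [e, le_div_iff₀ hd]
    simp only [Complex.normSq_apply, Complex.star_def, Complex.mul_re, Complex.conj_re,
      Complex.conj_im]
    nlinarith [sq_nonneg (r j * w.re - (s i + t * r j) * x.re),
      sq_nonneg (r j * w.im - (s i + t * r j) * x.im)]

theorem exists_resolventFunctional_eq (hU : Uᴴ * U = 1) (hV : Vᴴ * V = 1)
    (hr : ∀ i, 0 ≤ r i) (hs : ∀ i, 0 ≤ s i) {t : ℝ} (ht : 0 < t) :
    ∃ X, resolventFunctional (U * diagonal (fun i => (r i : ℂ)) * Uᴴ)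
        (V * diagonal (fun i => (s i : ℂ)) * Vᴴ) t X =
      ∑ i, ∑ j, r j * Complex.normSq ((Vᴴ * U) i j) / (s i / r j + t) := by
  refine ⟨V * (of fun i j => ((r j / (s i + t * r j) : ℝ) : ℂ) * (Vᴴ * U) i j) * Uᴴ, ?_⟩
  rw [resolventFunctional_conj hU hV]
  refine sum_congr rfl fun i _ => sum_congr rfl fun j _ => ?_
  simp only [of_apply]
  generalize (Vᴴ * U) i j = w
  rcases (hr j).eq_or_lt with h0 | h0
  · simp [← h0]
  · have hd : 0 < s i + t * r j := add_pos_of_nonneg_of_pos (hs i) (by positivity)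
    have e : r j * Complex.normSq w / (s i / r j + t) =
        r j ^ 2 * Complex.normSq w / (s i + t * r j) := by
      field_simp
    rw [e, Complex.normSq_mul, Complex.normSq_ofReal]
    have e2 (c : ℝ) : (star ((c : ℂ) * w) * w).re = c * Complex.normSq w := by
      simp [Complex.normSq_apply]
      ring
    rw [e2]
    field_simp
    ring

end Resolvent

theorem sum_normSq_col {N : Type*} [Fintype N] [DecidableEq N] {W : Matrix N N ℂ}
    (hW : Wᴴ * W = 1) (j : N) : ∑ i, Complex.normSq (W i j) = 1 := by
  have h := congrFun (congrFun hW j) j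
  simp only [mul_apply, conjTranspose_apply, one_apply_eq, Complex.star_def,
    ← Complex.normSq_eq_conj_mul_self] at h
  exact_mod_cast h

theorem sum_mul_normSq_eq {N : Type*} [Fintype N] [DecidableEq N] {U V : Matrix N N ℂ}
    (hU : Uᴴ * U = 1) (hV : Vᴴ * V = 1) (r : N → ℝ) :
    ∑ i, ∑ j, r j * Complex.normSq ((Vᴴ * U) i j) = ∑ j, r j := by
  have hW : (Vᴴ * U)ᴴ * (Vᴴ * U) = 1 := by
    rw [conjTranspose_mul, conjTranspose_conjTranspose, Matrix.mul_assoc,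
      ← Matrix.mul_assoc V, mul_eq_one_comm.1 hV, Matrix.one_mul, hU]
  rw [sum_comm]
  simp only [← mul_sum, sum_normSq_col hW, mul_one]

/-- Monotonicity of the relative entropy under the dual of a multiplicative star-preserving
map `Φ`, in terms of spectral decompositions. -/
theorem sum_log_div_le_of_dual {N M : Type*} [Fintype N] [DecidableEq N] [Fintype M]
    [DecidableEq M] {U V : Matrix N N ℂ} {r s : N → ℝ} {U' V' : Matrix M M ℂ} {r' s' : M → ℝ}
    (hU : Uᴴ * U = 1) (hV : Vᴴ * V = 1) (hU' : U'ᴴ * U' = 1) (hV' : V'ᴴ * V' = 1)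
    (hr : ∀ i, 0 ≤ r i) (hs : ∀ i, 0 ≤ s i) (hr' : ∀ i, 0 ≤ r' i) (hs' : ∀ i, 0 ≤ s' i)
    (hsupp : ∀ i j, r j * Complex.normSq ((Vᴴ * U) i j) ≠ 0 → s i ≠ 0)
    (hsupp' : ∀ i j, r' j * Complex.normSq ((V'ᴴ * U') i j) ≠ 0 → s' i ≠ 0)
    (hsum : ∑ i, r i = ∑ i, r' i)
    (Φ : Matrix M M ℂ → Matrix N N ℂ) (hΦstar : ∀ Y, Φ Yᴴ = (Φ Y)ᴴ)
    (hΦmul : ∀ Y Z, Φ (Y * Z) = Φ Y * Φ Z)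
    (hρ : ∀ Y, (Φ Y * (U * diagonal (fun i => (r i : ℂ)) * Uᴴ)).trace =
      (Y * (U' * diagonal (fun i => (r' i : ℂ)) * U'ᴴ)).trace)
    (hσ : ∀ Y, (Φ Y * (V * diagonal (fun i => (s i : ℂ)) * Vᴴ)).trace =
      (Y * (V' * diagonal (fun i => (s' i : ℂ)) * V'ᴴ)).trace) :
    ∑ i, ∑ j, r j * Complex.normSq ((Vᴴ * U) i j) * Real.log (s i / r j) ≤
      ∑ i, ∑ j, r' j * Complex.normSq ((V'ᴴ * U') i j) * Real.log (s' i / r' j) := by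
  have key := sum_mul_log_le_of_sum_div_le
    (p := fun x : N × N => r x.2 * Complex.normSq ((Vᴴ * U) x.1 x.2))
    (l := fun x => s x.1 / r x.2)
    (q := fun x : M × M => r' x.2 * Complex.normSq ((V'ᴴ * U') x.1 x.2))
    (m := fun x => s' x.1 / r' x.2)
    (fun x => div_nonneg (hs _) (hr _)) (fun x => div_nonneg (hs' _) (hr' _))
    (fun x hx => div_ne_zero (hsupp _ _ hx) (left_ne_zero_of_mul hx))
    (fun x hx => div_ne_zero (hsupp' _ _ hx) (left_ne_zero_of_mul hx))
  simp only [Fintype.sum_prod_type] at key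
  refine key (by rw [sum_mul_normSq_eq hU hV, sum_mul_normSq_eq hU' hV', hsum]) fun t ht => ?_
  obtain ⟨Y, hY⟩ := exists_resolventFunctional_eq hU' hV' hr' hs' ht
  rw [← hY]
  refine le_trans (le_of_eq ?_) (resolventFunctional_le hU hV hr hs ht (Φ Y))
  simp only [resolventFunctional, ← hΦstar, ← hΦmul, hρ, hσ]

section Spectral

variable {N : Type*} [Fintype N] [DecidableEq N] {A : Matrix N N ℂ}

theorem eigenvectorUnitary_conjTranspose_mul_self (hA : A.IsHermitian) :
    (hA.eigenvectorUnitary : Matrix N N ℂ)ᴴ * (hA.eigenvectorUnitary : Matrix N N ℂ) = 1 :=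
  Unitary.coe_star_mul_self hA.eigenvectorUnitary

theorem eq_eigenvectorUnitary_mul_diagonal_mul (hA : A.IsHermitian) :
    A = (hA.eigenvectorUnitary : Matrix N N ℂ) *
      diagonal (fun i => (hA.eigenvalues i : ℂ)) * (hA.eigenvectorUnitary : Matrix N N ℂ)ᴴ := by
  conv_lhs => rw [hA.spectral_theorem, Unitary.conjStarAlgAut_apply]
  rfl

theorem vnEntropy_eq_sum (hA : A.IsHermitian) :
    vnEntropy hA = -∑ i, hA.eigenvalues i * Real.logb 2 (hA.eigenvalues i) := by
  have hU := eigenvectorUnitary_conjTranspose_mul_self hA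
  have h : (A * matLog2 hA).trace =
      ((∑ i, hA.eigenvalues i * Real.logb 2 (hA.eigenvalues i) : ℝ) : ℂ) := by
    have hA' := eq_eigenvectorUnitary_mul_diagonal_mul hA
    rw [matLog2, star_eq_conjTranspose]
    generalize (hA.eigenvectorUnitary : Matrix N N ℂ) = U at *
    generalize hA.eigenvalues = r at *
    rw [hA']
    have e (D D' : Matrix N N ℂ) : U * D * Uᴴ * (U * D' * Uᴴ) =
        U * (D * (Uᴴ * U) * D' * Uᴴ) := by
      simp only [Matrix.mul_assoc]
    rw [e, hU, trace_mul_comm]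
    simp [Matrix.mul_assoc, hU, trace, diag_apply]
  rw [vnEntropy, h, Complex.neg_re, Complex.ofReal_re]

theorem vnEntropy_mul_log_two (hA : A.IsHermitian) :
    vnEntropy hA * Real.log 2 = -∑ i, hA.eigenvalues i * Real.log (hA.eigenvalues i) := by
  have : Real.log 2 ≠ 0 := by positivity
  rw [vnEntropy_eq_sum, neg_mul, sum_mul]
  simp only [Real.logb, mul_assoc, div_mul_cancel₀ _ this]

theorem vnEntropy_congr_charpoly {M : Type*} [Fintype M] [DecidableEq M] {B : Matrix M M ℂ}
    (hA : A.IsHermitian) (hB : B.IsHermitian) (h : A.charpoly = B.charpoly) :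
    vnEntropy hA = vnEntropy hB := by
  have hroots := hA.roots_charpoly_eq_eigenvalues.symm.trans
    ((congrArg Polynomial.roots h).trans hB.roots_charpoly_eq_eigenvalues)
  have := congrArg (fun m : Multiset ℂ => (m.map fun z => z.re * Real.logb 2 z.re).sum) hroots
  simp only [Multiset.map_map, Function.comp_def] at this
  rw [vnEntropy_eq_sum, vnEntropy_eq_sum]
  exact congrArg Neg.neg this

theorem vnEntropy_submatrix {M : Type*} [Fintype M] [DecidableEq M] (e : M ≃ N)
    (hA : A.IsHermitian) : vnEntropy (hA.submatrix e) = vnEntropy hA :=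
  vnEntropy_congr_charpoly _ _ (charpoly_reindex e.symm A)

end Spectral

section ConditionalEntropy

open scoped Kronecker

variable {α β : Type*} [Fintype α] [DecidableEq α] [Fintype β] [DecidableEq β]

theorem one_kronecker_conjTranspose_mul_self {V : Matrix β β ℂ} (hV : Vᴴ * V = 1) :
    ((1 : Matrix α α ℂ) ⊗ₖ V)ᴴ * ((1 : Matrix α α ℂ) ⊗ₖ V) = 1 := by
  rw [conjTranspose_kronecker, ← mul_kronecker_mul, hV, conjTranspose_one, Matrix.one_mul,
    one_kronecker_one]

theorem one_kronecker_spectral (V : Matrix β β ℂ) (s : β → ℝ) :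
    ((1 : Matrix α α ℂ) ⊗ₖ V) * diagonal (fun i : α × β => (s i.2 : ℂ)) *
        ((1 : Matrix α α ℂ) ⊗ₖ V)ᴴ =
      (1 : Matrix α α ℂ) ⊗ₖ (V * diagonal (fun i => (s i : ℂ)) * Vᴴ) := by
  have h : diagonal (fun i : α × β => (s i.2 : ℂ)) =
      (1 : Matrix α α ℂ) ⊗ₖ diagonal (fun i => (s i : ℂ)) := by
    rw [← diagonal_one, diagonal_kronecker_diagonal]
    simp
  rw [h, conjTranspose_kronecker, ← mul_kronecker_mul, ← mul_kronecker_mul, conjTranspose_one,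
    Matrix.one_mul, Matrix.one_mul]

theorem conj_diagonal_apply_self {N : Type*} [Fintype N] [DecidableEq N] (W : Matrix N N ℂ)
    (r : N → ℝ) (i : N) :
    (W * diagonal (fun j => (r j : ℂ)) * Wᴴ) i i =
      ((∑ j, r j * Complex.normSq (W i j) : ℝ) : ℂ) := by
  rw [mul_apply]
  simp only [mul_diagonal, conjTranspose_apply]
  push_cast
  refine sum_congr rfl fun j _ => ?_
  rw [Complex.normSq_eq_conj_mul_self, Complex.star_def]
  ring

/-- Pairing a bipartite matrix with the eigenbasis of its marginal, summed over the traced-out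
factor, gives the eigenvalues of the marginal. -/
theorem sum_normSq_one_kronecker {U : Matrix (α × β) (α × β) ℂ} {r : α × β → ℝ}
    {V : Matrix β β ℂ} {s : β → ℝ} (hV : Vᴴ * V = 1)
    (hmarg : ∀ b b', (V * diagonal (fun i => (s i : ℂ)) * Vᴴ) b b' =
      ∑ a, (U * diagonal (fun i => (r i : ℂ)) * Uᴴ) (a, b) (a, b')) (i : β) :
    ∑ a, ∑ j, r j * Complex.normSq ((((1 : Matrix α α ℂ) ⊗ₖ V)ᴴ * U) (a, i) j) = s i := by
  have key : ∑ a, ((((1 : Matrix α α ℂ) ⊗ₖ V)ᴴ * U) * diagonal (fun j => (r j : ℂ)) *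
      (((1 : Matrix α α ℂ) ⊗ₖ V)ᴴ * U)ᴴ) (a, i) (a, i) = (s i : ℂ) := by
    have e1 : (((1 : Matrix α α ℂ) ⊗ₖ V)ᴴ * U) * diagonal (fun j => (r j : ℂ)) *
        (((1 : Matrix α α ℂ) ⊗ₖ V)ᴴ * U)ᴴ = ((1 : Matrix α α ℂ) ⊗ₖ V)ᴴ *
          (U * diagonal (fun j => (r j : ℂ)) * Uᴴ) * ((1 : Matrix α α ℂ) ⊗ₖ V) := by
      simp only [conjTranspose_mul, conjTranspose_conjTranspose, Matrix.mul_assoc]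
    have e2 : Vᴴ * (V * diagonal (fun i => (s i : ℂ)) * Vᴴ) * V =
        diagonal (fun i => (s i : ℂ)) := by
      rw [Matrix.mul_assoc, Matrix.mul_assoc, Matrix.mul_assoc, hV, Matrix.mul_one,
        ← Matrix.mul_assoc, hV, Matrix.one_mul]
    have e3 := congrFun (congrFun e2 i) i
    rw [diagonal_apply_eq] at e3
    rw [e1, ← e3]
    generalize (U * diagonal (fun i => (r i : ℂ)) * Uᴴ) = R at *
    generalize (V * diagonal (fun i => (s i : ℂ)) * Vᴴ) = Q at *
    simp only [mul_apply, conjTranspose_apply, kroneckerMap_apply, Fintype.sum_prod_type,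
      one_apply, hmarg, mul_sum, sum_mul, ite_mul, mul_ite, one_mul, zero_mul, mul_zero,
      apply_ite star, star_zero]
    simp [sum_comm (s := (univ : Finset α)) (t := (univ : Finset β))]
  have : ((∑ a, ∑ j, r j * Complex.normSq ((((1 : Matrix α α ℂ) ⊗ₖ V)ᴴ * U) (a, i) j) : ℝ) : ℂ)
      = (s i : ℂ) := by
    rw [← key, Complex.ofReal_sum]
    exact sum_congr rfl fun a _ => (conj_diagonal_apply_self _ _ _).symm
  exact_mod_cast this

theorem support_one_kronecker {U : Matrix (α × β) (α × β) ℂ} {r : α × β → ℝ}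
    {V : Matrix β β ℂ} {s : β → ℝ} (hV : Vᴴ * V = 1) (hr : ∀ i, 0 ≤ r i)
    (hmarg : ∀ b b', (V * diagonal (fun i => (s i : ℂ)) * Vᴴ) b b' =
      ∑ a, (U * diagonal (fun i => (r i : ℂ)) * Uᴴ) (a, b) (a, b')) (i j : α × β)
    (hij : r j * Complex.normSq ((((1 : Matrix α α ℂ) ⊗ₖ V)ᴴ * U) i j) ≠ 0) : s i.2 ≠ 0 := by
  intro h0
  have hsum := sum_normSq_one_kronecker hV hmarg i.2
  have hnn (x y) : 0 ≤ r y * Complex.normSq ((((1 : Matrix α α ℂ) ⊗ₖ V)ᴴ * U) x y) :=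
    mul_nonneg (hr y) (Complex.normSq_nonneg _)
  rw [h0, sum_eq_zero_iff_of_nonneg fun a _ => sum_nonneg fun j _ => hnn _ _] at hsum
  have h1 := hsum i.1 (mem_univ _)
  rw [sum_eq_zero_iff_of_nonneg fun j _ => hnn _ _] at h1
  exact hij (h1 j (mem_univ _))

theorem sum_log_div_one_kronecker {U : Matrix (α × β) (α × β) ℂ} {r : α × β → ℝ}
    {V : Matrix β β ℂ} {s : β → ℝ} (hU : Uᴴ * U = 1) (hV : Vᴴ * V = 1) (hr : ∀ i, 0 ≤ r i)
    (hmarg : ∀ b b', (V * diagonal (fun i => (s i : ℂ)) * Vᴴ) b b' =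
      ∑ a, (U * diagonal (fun i => (r i : ℂ)) * Uᴴ) (a, b) (a, b')) :
    ∑ i, ∑ j, r j * Complex.normSq ((((1 : Matrix α α ℂ) ⊗ₖ V)ᴴ * U) i j) *
        Real.log (s i.2 / r j) =
      ∑ i, s i * Real.log (s i) - ∑ j, r j * Real.log (r j) := by
  have hterm (i j : α × β) : r j * Complex.normSq ((((1 : Matrix α α ℂ) ⊗ₖ V)ᴴ * U) i j) *
        Real.log (s i.2 / r j) =
      r j * Complex.normSq ((((1 : Matrix α α ℂ) ⊗ₖ V)ᴴ * U) i j) * Real.log (s i.2) -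
      r j * Real.log (r j) * Complex.normSq ((((1 : Matrix α α ℂ) ⊗ₖ V)ᴴ * U) i j) := by
    by_cases h : r j * Complex.normSq ((((1 : Matrix α α ℂ) ⊗ₖ V)ᴴ * U) i j) = 0
    · rw [mul_right_comm (r j) (Real.log (r j)), h]
      simp
    · rw [Real.log_div (support_one_kronecker hV hr hmarg i j h) (left_ne_zero_of_mul h)]
      ring
  simp only [hterm, sum_sub_distrib]
  rw [sum_mul_normSq_eq hU (one_kronecker_conjTranspose_mul_self hV) fun j => r j * Real.log (r j)]
  congr 1
  simp only [← sum_mul]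
  rw [Fintype.sum_prod_type_right]
  refine sum_congr rfl fun i _ => ?_
  dsimp only
  rw [← sum_mul, sum_normSq_one_kronecker hV hmarg]

end ConditionalEntropy

section StrongSubadditivity

open scoped Kronecker

variable {α β γ : Type*} [DecidableEq γ]

/-- The embedding `Y ↦ Y ⊗ 1` of operators on `α × β` into operators on `α × β × γ`. -/
def ampliate (Y : Matrix (α × β) (α × β) ℂ) : Matrix (α × β × γ) (α × β × γ) ℂ :=
  (Y ⊗ₖ (1 : Matrix γ γ ℂ)).submatrix (Equiv.prodAssoc α β γ).symm (Equiv.prodAssoc α β γ).symm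

theorem ampliate_conjTranspose (Y : Matrix (α × β) (α × β) ℂ) :
    ampliate (γ := γ) Yᴴ = (ampliate Y)ᴴ := by
  rw [ampliate, ampliate, conjTranspose_submatrix, conjTranspose_kronecker, conjTranspose_one]

variable [Fintype α] [Fintype β] [Fintype γ]

theorem ampliate_mul (Y Z : Matrix (α × β) (α × β) ℂ) :
    ampliate (γ := γ) (Y * Z) = ampliate Y * ampliate Z := by
  rw [ampliate, ampliate, ampliate, submatrix_mul_equiv, ← mul_kronecker_mul, Matrix.one_mul]

theorem trace_ampliate_mul (Y : Matrix (α × β) (α × β) ℂ)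
    {R : Matrix (α × β × γ) (α × β × γ) ℂ} {Q : Matrix (α × β) (α × β) ℂ}
    (hQ : ∀ x x', Q x x' = ∑ c, R (x.1, x.2, c) (x'.1, x'.2, c)) :
    (ampliate Y * R).trace = (Y * Q).trace := by
  simp only [trace, diag_apply, mul_apply, ampliate, submatrix_apply, kroneckerMap_apply,
    Fintype.sum_prod_type, one_apply, hQ, mul_sum, Equiv.prodAssoc_symm_apply, mul_ite, mul_one,
    mul_zero, ite_mul, zero_mul, sum_ite_eq, mem_univ, if_true]
  refine sum_congr rfl fun a _ => sum_congr rfl fun b _ => ?_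
  rw [sum_comm]
  refine sum_congr rfl fun a' _ => ?_
  rw [sum_comm]

variable [DecidableEq α] [DecidableEq β]

/-- Strong subadditivity of the von Neumann entropy. -/
theorem vnEntropy_strong_subadditivity {ρ : Matrix (α × β × γ) (α × β × γ) ℂ}
    {ρ₁₂ : Matrix (α × β) (α × β) ℂ} {ρ₂₃ : Matrix (β × γ) (β × γ) ℂ} {ρ₂ : Matrix β β ℂ}
    (hρ : ρ.PosSemidef) (hρ₁₂ : ρ₁₂.PosSemidef) (hρ₂₃ : ρ₂₃.PosSemidef) (hρ₂ : ρ₂.PosSemidef)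
    (h₂₃ : ∀ y y', ρ₂₃ y y' = ∑ a, ρ (a, y) (a, y'))
    (h₁₂ : ∀ x x', ρ₁₂ x x' = ∑ c, ρ (x.1, x.2, c) (x'.1, x'.2, c))
    (h₂ : ∀ b b', ρ₂ b b' = ∑ a, ρ₁₂ (a, b) (a, b')) :
    vnEntropy hρ.1 + vnEntropy hρ₂.1 ≤ vnEntropy hρ₁₂.1 + vnEntropy hρ₂₃.1 := by
  have htrace : ∑ i, hρ.1.eigenvalues i = ∑ i, hρ₁₂.1.eigenvalues i := by
    have h : ρ.trace = ρ₁₂.trace := by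
      simp [trace, Fintype.sum_prod_type, h₁₂]
    rw [hρ.1.trace_eq_sum_eigenvalues, hρ₁₂.1.trace_eq_sum_eigenvalues] at h
    exact_mod_cast h
  have h₂' (b b') : ρ₂ b b' = ∑ c, ρ₂₃ (b, c) (b', c) := by
    simp only [h₂, h₁₂, h₂₃]
    exact sum_comm
  have hσ (Y : Matrix (α × β) (α × β) ℂ) :
      (ampliate Y * ((1 : Matrix α α ℂ) ⊗ₖ ρ₂₃)).trace =
        (Y * ((1 : Matrix α α ℂ) ⊗ₖ ρ₂)).trace :=
    trace_ampliate_mul Y fun x x' => by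
      simp only [kroneckerMap_apply, h₂', mul_sum]
  have hd := eq_eigenvectorUnitary_mul_diagonal_mul hρ.1
  have hd₁₂ := eq_eigenvectorUnitary_mul_diagonal_mul hρ₁₂.1
  have hd₂₃ := eq_eigenvectorUnitary_mul_diagonal_mul hρ₂₃.1
  have hd₂ := eq_eigenvectorUnitary_mul_diagonal_mul hρ₂.1
  have hU := eigenvectorUnitary_conjTranspose_mul_self hρ.1
  have hU₁₂ := eigenvectorUnitary_conjTranspose_mul_self hρ₁₂.1
  have hU₂₃ := eigenvectorUnitary_conjTranspose_mul_self hρ₂₃.1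
  have hU₂ := eigenvectorUnitary_conjTranspose_mul_self hρ₂.1
  have hm := h₂₃
  rw [hd, hd₂₃] at hm
  have hm' := h₂
  rw [hd₁₂, hd₂] at hm'
  have key := sum_log_div_le_of_dual hU (one_kronecker_conjTranspose_mul_self hU₂₃) hU₁₂
    (one_kronecker_conjTranspose_mul_self (α := α) hU₂) hρ.eigenvalues_nonneg
    (fun i => hρ₂₃.eigenvalues_nonneg i.2) hρ₁₂.eigenvalues_nonneg
    (fun i => hρ₂.eigenvalues_nonneg i.2)
    (support_one_kronecker hU₂₃ hρ.eigenvalues_nonneg hm)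
    (support_one_kronecker hU₂ hρ₁₂.eigenvalues_nonneg hm') htrace
    ampliate ampliate_conjTranspose ampliate_mul
    (by rw [← hd, ← hd₁₂]; exact fun Y => trace_ampliate_mul Y h₁₂)
    (by rw [one_kronecker_spectral, one_kronecker_spectral, ← hd₂₃, ← hd₂]; exact hσ)
  rw [sum_log_div_one_kronecker hU hU₂₃ hρ.eigenvalues_nonneg hm,
    sum_log_div_one_kronecker hU₁₂ hU₂ hρ₁₂.eigenvalues_nonneg hm'] at key
  refine le_of_mul_le_mul_right ?_ (Real.log_pos one_lt_two)
  rw [add_mul, add_mul, vnEntropy_mul_log_two, vnEntropy_mul_log_two, vnEntropy_mul_log_two,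
    vnEntropy_mul_log_two]
  linarith

end StrongSubadditivity

section Reduction

variable {n : ℕ}

/-- Join assignments on `s` and `t` to one on `u`, intended for `u = s ∪ t`. -/
def glueBits (s t u : Finset (Fin n)) (f : {i : Fin n // i ∈ s} → Bool)
    (g : {i : Fin n // i ∈ t} → Bool) : {i : Fin n // i ∈ u} → Bool :=
  fun i => if h : i.1 ∈ s then f ⟨i, h⟩ else if h : i.1 ∈ t then g ⟨i, h⟩ else false

theorem glueBits_comm {s t : Finset (Fin n)} (hst : Disjoint s t) (u : Finset (Fin n))
    (f : {i : Fin n // i ∈ s} → Bool) (g : {i : Fin n // i ∈ t} → Bool) :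
    glueBits s t u f g = glueBits t s u g f := by
  funext i
  by_cases hs : i.1 ∈ s
  · simp [glueBits, hs, Finset.disjoint_left.1 hst hs]
  · simp [glueBits, hs]

/-- Assignments on a disjoint union are pairs of assignments. -/
def glueEquiv {s t u : Finset (Fin n)} (hst : Disjoint s t) (hu : s ∪ t = u) :
    ({i : Fin n // i ∈ s} → Bool) × ({i : Fin n // i ∈ t} → Bool) ≃
      ({i : Fin n // i ∈ u} → Bool) where
  toFun x := glueBits s t u x.1 x.2
  invFun f := (fun i => f ⟨i, hu ▸ mem_union_left t i.2⟩,
    fun i => f ⟨i, hu ▸ mem_union_right s i.2⟩)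
  left_inv x := by
    ext i
    · simp [glueBits]
    · simp [glueBits, Finset.disjoint_right.1 hst i.2]
  right_inv f := by
    funext i
    have hi : i.1 ∈ s ∨ i.1 ∈ t := mem_union.1 (hu ▸ i.2)
    by_cases hs : i.1 ∈ s
    · simp [glueBits, hs]
    · simp [glueBits, hs, hi.resolve_left hs]

/-- Assignments off `s` are pairs of assignments on `t` and off `u = s ∪ t`. -/
def complEquiv {s t u : Finset (Fin n)} (hst : Disjoint s t) (hu : s ∪ t = u) :
    ({i : Fin n // i ∉ s} → Bool) ≃
      ({i : Fin n // i ∈ t} → Bool) × ({i : Fin n // i ∉ u} → Bool) where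
  toFun m := (fun i => m ⟨i, Finset.disjoint_right.1 hst i.2⟩,
    fun i => m ⟨i, fun h => i.2 ((Finset.ext_iff.1 hu _).1 (mem_union_left t h))⟩)
  invFun x := fun i => if h : i.1 ∈ t then x.1 ⟨i, h⟩ else
    x.2 ⟨i, fun h' => (mem_union.1 ((Finset.ext_iff.1 hu _).2 h')).elim i.2 h⟩
  left_inv m := by
    funext i
    by_cases h : i.1 ∈ t <;> simp [h]
  right_inv x := by
    ext i
    · simp
    · have : i.1 ∉ t := fun h =>
        i.2 ((Finset.ext_iff.1 hu _).1 (mem_union_right s h))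
      simp [this]

theorem combineBits_complEquiv_symm {s t u : Finset (Fin n)} (hst : Disjoint s t)
    (hu : s ∪ t = u) (f : {i : Fin n // i ∈ s} → Bool) (g : {i : Fin n // i ∈ t} → Bool)
    (k : {i : Fin n // i ∉ u} → Bool) :
    combineBits s f ((complEquiv hst hu).symm (g, k)) =
      combineBits u (glueBits s t u f g) k := by
  subst hu
  funext i
  by_cases hs : i ∈ s
  · simp [combineBits, glueBits, hs]
  · by_cases ht : i ∈ t
    · simp [combineBits, glueBits, complEquiv, hs, ht]
    · simp [combineBits, complEquiv, hs, ht]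

theorem reduceTo_eq_sum_right (ρ : Matrix (Fin n → Bool) (Fin n → Bool) ℂ)
    {s t u : Finset (Fin n)} (hst : Disjoint s t) (hu : s ∪ t = u)
    (f f' : {i : Fin n // i ∈ s} → Bool) :
    reduceTo ρ s f f' =
      ∑ g, reduceTo ρ u (glueBits s t u f g) (glueBits s t u f' g) := by
  simp only [reduceTo, of_apply]
  rw [← (complEquiv hst hu).symm.sum_comp, Fintype.sum_prod_type]
  simp only [combineBits_complEquiv_symm]

theorem reduceTo_eq_sum_left (ρ : Matrix (Fin n → Bool) (Fin n → Bool) ℂ)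
    {s t u : Finset (Fin n)} (hst : Disjoint s t) (hu : s ∪ t = u)
    (g g' : {i : Fin n // i ∈ t} → Bool) :
    reduceTo ρ t g g' =
      ∑ f, reduceTo ρ u (glueBits s t u f g) (glueBits s t u f g') := by
  rw [reduceTo_eq_sum_right ρ hst.symm ((union_comm t s).trans hu)]
  simp only [glueBits_comm hst]

theorem reduceTo_posSemidef {ρ : Matrix (Fin n → Bool) (Fin n → Bool) ℂ} (hρ : ρ.PosSemidef)
    (s : Finset (Fin n)) : (reduceTo ρ s).PosSemidef := by
  have h : reduceTo ρ s = ∑ g : {i : Fin n // i ∉ s} → Bool,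
      ρ.submatrix (fun f => combineBits s f g) (fun f => combineBits s f g) := by
    ext f f'
    simp [reduceTo, Matrix.sum_apply]
  rw [h]
  exact posSemidef_sum _ fun g _ => hρ.submatrix _

theorem vnEntropy_reduceTo_submodular {ρ : Matrix (Fin n → Bool) (Fin n → Bool) ℂ}
    (hρ : ρ.PosSemidef) (hred : ∀ s : Finset (Fin n), (reduceTo ρ s).IsHermitian)
    {a s c : Finset (Fin n)} (has : Disjoint a s) (hac : Disjoint a c) (hsc : Disjoint s c) :
    vnEntropy (hred (a ∪ (s ∪ c))) + vnEntropy (hred s) ≤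
      vnEntropy (hred (a ∪ s)) + vnEntropy (hred (s ∪ c)) := by
  have hasc : Disjoint a (s ∪ c) := disjoint_union_right.2 ⟨has, hac⟩
  have hassoc (f g h) : glueBits a (s ∪ c) (a ∪ (s ∪ c)) f (glueBits s c (s ∪ c) g h) =
      glueBits (a ∪ s) c (a ∪ (s ∪ c)) (glueBits a s (a ∪ s) f g) h := by
    funext i
    by_cases ha : i.1 ∈ a <;> by_cases hs : i.1 ∈ s <;> by_cases hc : i.1 ∈ c <;>
      simp [glueBits, ha, hs, hc]
  have hpsd := reduceTo_posSemidef hρ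
  have key := vnEntropy_strong_subadditivity
    ((hpsd (a ∪ (s ∪ c))).submatrix
      (((Equiv.refl _).prodCongr (glueEquiv hsc rfl)).trans (glueEquiv hasc rfl)))
    ((hpsd (a ∪ s)).submatrix (glueEquiv has rfl))
    ((hpsd (s ∪ c)).submatrix (glueEquiv hsc rfl)) (hpsd s)
    (fun y y' => reduceTo_eq_sum_left ρ hasc rfl _ _)
    (fun x x' => (reduceTo_eq_sum_right ρ (disjoint_union_left.2 ⟨hac, hsc⟩)
      (union_assoc a s c) _ _).trans (sum_congr rfl fun h _ =>
        congrArg₂ _ (hassoc _ _ _).symm (hassoc _ _ _).symm))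
    (fun b b' => reduceTo_eq_sum_left ρ has rfl _ _)
  rwa [vnEntropy_submatrix, vnEntropy_submatrix, vnEntropy_submatrix] at key

theorem trace_reduceTo (ρ : Matrix (Fin n → Bool) (Fin n → Bool) ℂ) (s : Finset (Fin n)) :
    (reduceTo ρ s).trace = ρ.trace := by
  simp only [trace, diag_apply, reduceTo, of_apply]
  rw [← Fintype.sum_prod_type']
  exact Fintype.sum_equiv (Equiv.piEquivPiSubtypeProd (· ∈ s) fun _ => Bool).symm _ _
    fun _ => rfl

theorem vnEntropy_eq_zero_of_unique {N : Type*} [Fintype N] [DecidableEq N] [Unique N]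
    {A : Matrix N N ℂ} (hA : A.IsHermitian) (htr : A.trace = 1) : vnEntropy hA = 0 := by
  rw [hA.trace_eq_sum_eigenvalues, Fintype.sum_unique] at htr
  have h1 : hA.eigenvalues default = 1 := Complex.ofReal_eq_one.1 htr
  rw [vnEntropy_eq_sum, Fintype.sum_unique, h1]
  simp

theorem vnEntropy_reduceTo_empty {ρ : Matrix (Fin n → Bool) (Fin n → Bool) ℂ}
    (hρ : ρ.trace = 1) (h : (reduceTo ρ ∅).IsHermitian) : vnEntropy h = 0 :=
  vnEntropy_eq_zero_of_unique h ((trace_reduceTo ρ ∅).trans hρ)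

theorem vnEntropy_reduceTo_univ {ρ : Matrix (Fin n → Bool) (Fin n → Bool) ℂ}
    (hρ : ρ.IsHermitian) (h : (reduceTo ρ univ).IsHermitian) : vnEntropy h = vnEntropy hρ := by
  have : IsEmpty {i : Fin n // i ∉ (univ : Finset (Fin n))} := ⟨fun i => i.2 (mem_univ _)⟩
  have e : reduceTo ρ univ = ρ.submatrix
      ((Equiv.subtypeUnivEquiv (fun i => mem_univ (α := Fin n) i)).arrowCongr (Equiv.refl Bool))
      ((Equiv.subtypeUnivEquiv (fun i => mem_univ (α := Fin n) i)).arrowCongr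
        (Equiv.refl Bool)) := by
    ext f f'
    simp [reduceTo]
    congr 1 <;> funext i <;> simp [combineBits]
  rw [← vnEntropy_submatrix ((Equiv.subtypeUnivEquiv (fun i => mem_univ (α := Fin n) i)).arrowCongr
    (Equiv.refl Bool)) hρ]
  exact vnEntropy_congr_charpoly _ _ (congrArg charpoly e)

end Reduction

theorem card_filter_mem_powersetCard {n k : ℕ} (hk : 0 < k) (a : Fin n) :
    #{s ∈ (univ : Finset (Fin n)).powersetCard k | a ∈ s} = (n - 1).choose (k - 1) := by
  have h : #((univ.erase a).powersetCard (k - 1)) = (n - 1).choose (k - 1) := by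
    rw [card_powersetCard, card_erase_of_mem (mem_univ a), card_univ, Fintype.card_fin]
  rw [← h]
  refine card_nbij' (fun s => s.erase a) (fun s => insert a s) ?_ ?_ ?_ ?_
  · intro s hs
    simp only [coe_filter, Set.mem_ofPred_eq, mem_powersetCard] at hs
    simp only [mem_coe, mem_powersetCard, card_erase_of_mem hs.2, hs.1.2, and_true]
    exact erase_subset_erase a hs.1.1
  · intro s hs
    simp only [mem_coe, mem_powersetCard] at hs
    have has : a ∉ s := fun h => notMem_erase a _ (hs.1 h)
    simp only [coe_filter, Set.mem_ofPred_eq, mem_powersetCard, subset_univ, true_and,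
      mem_insert_self, and_true, card_insert_of_notMem has, hs.2]
    omega
  · intro s hs
    simp only [coe_filter, Set.mem_ofPred_eq] at hs
    exact insert_erase hs.2
  · intro s hs
    simp only [mem_coe, mem_powersetCard] at hs
    exact erase_insert fun h => notMem_erase a _ (hs.1 h)

/-- Shearer's inequality for the family of all `k`-subsets and a set function with decreasing
increments, not assumed monotone. -/
theorem sum_powersetCard_ge_of_submodular {n k : ℕ} (hk : 0 < k) (f : Finset (Fin n) → ℝ)
    (h0 : f ∅ = 0)
    (hf : ∀ s t a, s ⊆ t → a ∉ t → f (insert a t) + f s ≤ f (insert a s) + f t) :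
    ((n - 1).choose (k - 1) : ℝ) * f univ ≤ ∑ s ∈ univ.powersetCard k, f s := by
  set g : ℕ → ℝ := fun m => f (univ.filter fun i => i.val < m) with hg
  have hchain (s : Finset (Fin n)) : ∑ a ∈ s, (g (a + 1) - g a) ≤ f s := by
    induction s using Finset.induction_on_max with
    | empty => simp [h0]
    | insert a s hs ih =>
      have has : a ∉ s := fun h => lt_irrefl _ (hs a h)
      rw [sum_insert has]
      have h1 := hf s (univ.filter fun i => i.val < a.val) a
        (fun x hx => by simpa using hs x hx) (by simp)
      have h2 : insert a (univ.filter fun i : Fin n => i.val < a.val) =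
          univ.filter fun i => i.val < a.val + 1 := by
        ext x
        simp [Fin.ext_iff]
        omega
      rw [h2] at h1
      simp only [hg] at ih ⊢
      linarith
  have htel : ∑ a : Fin n, (g (a + 1) - g a) = f univ := by
    rw [Fin.sum_univ_eq_sum_range (fun m => g (m + 1) - g m) n, sum_range_sub]
    simp [hg, h0]
  calc ((n - 1).choose (k - 1) : ℝ) * f univ
      = ∑ a : Fin n, ∑ s ∈ (univ : Finset (Fin n)).powersetCard k with a ∈ s,
          (g (a + 1) - g a) := by
        simp only [sum_const, card_filter_mem_powersetCard hk, nsmul_eq_mul, ← mul_sum, htel]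
    _ = ∑ s ∈ (univ : Finset (Fin n)).powersetCard k, ∑ a ∈ s, (g (a + 1) - g a) := by
        refine sum_comm' ?_
        simp [and_comm]
    _ ≤ _ := sum_le_sum fun s _ => hchain s

/-- Averaged subsystem information bound: for a density matrix `ρ` of `n` qubits and
`0 < k < n`, the average over all `k`-element subsets `A` of the qubits of the information
`I(ρ|_A) = k − S(ρ|_A)` of the reduced density matrices is at most `(k/n)·I(ρ)`, where
`I(ρ) = n − S(ρ)`. -/
theorem averaged_subsystem_info {n k : ℕ} (hk0 : 0 < k) (hkn : k < n)
    {ρ : Matrix (Fin n → Bool) (Fin n → Bool) ℂ} (hρ : IsDensityMatrix ρ)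
    (hred : ∀ s : Finset (Fin n), (reduceTo ρ s).IsHermitian) :
    (1 / (n.choose k : ℝ)) *
        ∑ s ∈ univ.powersetCard k, ((k : ℝ) - vnEntropy (hred s)) ≤
      ((k : ℝ) / n) * ((n : ℝ) - vnEntropy hρ.1.1) := by
  have hshearer := sum_powersetCard_ge_of_submodular hk0 (fun s => vnEntropy (hred s))
    (vnEntropy_reduceTo_empty hρ.2 _) fun s t a hst hat => by
      have h := vnEntropy_reduceTo_submodular hρ.1 hred (a := {a}) (s := s) (c := t \ s)
        (disjoint_singleton_left.2 fun h => hat (hst h))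
        (disjoint_singleton_left.2 fun h => hat (mem_sdiff.1 h).1) disjoint_sdiff
      rwa [union_sdiff_of_subset hst, ← insert_eq, ← insert_eq] at h
  rw [vnEntropy_reduceTo_univ hρ.1.1] at hshearer
  have hC : (0 : ℝ) < n.choose k := by exact_mod_cast Nat.choose_pos hkn.le
  have hn : (0 : ℝ) < n := by exact_mod_cast hk0.trans hkn
  have hchoose : (n : ℝ) * (n - 1).choose (k - 1) = n.choose k * k := by
    obtain ⟨n, rfl⟩ := Nat.exists_eq_succ_of_ne_zero (hk0.trans hkn).ne'
    obtain ⟨k, rfl⟩ := Nat.exists_eq_succ_of_ne_zero hk0.ne'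
    exact_mod_cast Nat.add_one_mul_choose_eq n k
  rw [sum_sub_distrib, sum_const, card_powersetCard, card_univ, Fintype.card_fin, nsmul_eq_mul,
    one_div_mul_eq_div, div_le_iff₀ hC]
  have hcoef : ((n - 1).choose (k - 1) : ℝ) = (k : ℝ) / n * n.choose k := by
    field_simp
    linarith
  rw [hcoef] at hshearer
  have hk : (k : ℝ) / n * n = k := div_mul_cancel₀ _ hn.ne'
  linear_combination hshearer - (n.choose k : ℝ) * hk
end

section
/- (Quantum depolarizing noise contracts information) Let ρ be a density matrix of n qubits, and let σ be obtained by independently replacing each qubit, with probability p, by the maximally mixed single-qubit state ρ_R = (|0⟩⟨0| + |1⟩⟨1|)/2. Then I(σ) ≤ (1−p)·I(ρ), where I(τ) = n − S(τ) and S is von Neumann entropy in bits. -/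
open Matrix ComplexOrder

/-- Replace qubit `i` of an `n`-qubit state by the maximally mixed single-qubit state
`ρ_R = (|0⟩⟨0| + |1⟩⟨1|)/2`, i.e. form `Tr_i(ρ) ⊗ ρ_R` in position `i`. -/
noncomputable def replaceQubit {n : ℕ} (i : Fin n)
    (ρ : Matrix (Fin n → Bool) (Fin n → Bool) ℂ) :
    Matrix (Fin n → Bool) (Fin n → Bool) ℂ :=
  Matrix.of fun f g =>
    if f i = g i then
      (1 / 2 : ℂ) * ∑ b : Bool, ρ (Function.update f i b) (Function.update g i b)
    else 0

/-- The depolarizing noise channel: independently for each qubit, with probability `p`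
replace it by the maximally mixed state `ρ_R`. -/
noncomputable def depolarize {n : ℕ} (p : ℝ)
    (ρ : Matrix (Fin n → Bool) (Fin n → Bool) ℂ) :
    Matrix (Fin n → Bool) (Fin n → Bool) ℂ :=
  (List.finRange n).foldr
    (fun i τ => ((1 - p : ℝ) : ℂ) • τ + ((p : ℝ) : ℂ) • replaceQubit i τ) ρ

open scoped Interval

section RelativeEntropy

variable {m : Type*} [Fintype m] [DecidableEq m]

/-- The negative entropy `Tr(x log x)` of a Hermitian matrix, with the natural logarithm. -/
noncomputable def negEntropy (x : Matrix m m ℂ) : ℝ :=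
  (x * cfc Real.log x).trace.re

/-- The unnormalized relative entropy `Tr(x log x - x log y - x + y)`, with the natural
logarithm. -/
noncomputable def relEntropy (x y : Matrix m m ℂ) : ℝ :=
  (x * cfc Real.log x).trace.re - (x * cfc Real.log y).trace.re - x.trace.re + y.trace.re

/-- A functional, affine in `(x, y)`, whose supremum over `X` is the value at `x - y` of the
quadratic form inverse to `X ↦ s x X + (1 - s) X y`. -/
noncomputable def relObjective (s : ℝ) (x y X : Matrix m m ℂ) : ℝ :=
  2 * (Xᴴ * (x - y)).trace.re - s * (Xᴴ * x * X).trace.re - (1 - s) * (Xᴴ * X * y).trace.re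

/-- The matrix of overlaps between the eigenbases of two Hermitian matrices. -/
noncomputable def eigenOverlap {x y : Matrix m m ℂ} (hx : x.IsHermitian) (hy : y.IsHermitian) :
    Matrix m m ℂ :=
  star (hx.eigenvectorUnitary : Matrix m m ℂ) * (hy.eigenvectorUnitary : Matrix m m ℂ)

/-- The supremum of `relObjective s x y`, written in the eigenbases of `x` and `y`. -/
noncomputable def relSup (s : ℝ) {x y : Matrix m m ℂ} (hx : x.IsHermitian)
    (hy : y.IsHermitian) : ℝ :=
  ∑ i, ∑ j, ‖eigenOverlap hx hy i j‖ ^ 2 *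
    ((hx.eigenvalues i - hy.eigenvalues j) ^ 2 /
      (s * hx.eigenvalues i + (1 - s) * hy.eigenvalues j))

lemma cfc_eq_conj_diagonal {x : Matrix m m ℂ} (hx : x.IsHermitian) (f : ℝ → ℝ) :
    cfc f x = (hx.eigenvectorUnitary : Matrix m m ℂ) *
      diagonal (fun i => (f (hx.eigenvalues i) : ℂ)) *
      star (hx.eigenvectorUnitary : Matrix m m ℂ) := by
  rw [hx.cfc_eq, IsHermitian.cfc, Unitary.conjStarAlgAut_apply]
  rfl

lemma eq_conj_diagonal {x : Matrix m m ℂ} (hx : x.IsHermitian) :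
    x = (hx.eigenvectorUnitary : Matrix m m ℂ) *
      diagonal (fun i => (hx.eigenvalues i : ℂ)) *
      star (hx.eigenvectorUnitary : Matrix m m ℂ) := by
  have h := cfc_eq_conj_diagonal hx id
  rwa [cfc_id ℝ x hx.isSelfAdjoint] at h

lemma trace_diagonal_sandwich (a b : m → ℝ) (W : Matrix m m ℂ) :
    (Wᴴ * (diagonal (fun i => (a i : ℂ)) * W * diagonal (fun j => (b j : ℂ)))).trace.re
      = ∑ i, ∑ j, ‖W i j‖ ^ 2 * (a i * b j) := by
  rw [trace, Finset.sum_congr rfl fun j _ => diag_apply _ j]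
  simp_rw [mul_apply (M := Wᴴ), mul_diagonal, diagonal_mul, conjTranspose_apply]
  rw [Finset.sum_comm, Complex.re_sum]
  refine Finset.sum_congr rfl fun i _ => ?_
  rw [Complex.re_sum]
  refine Finset.sum_congr rfl fun j _ => ?_
  rw [← Complex.normSq_eq_norm_sq, Complex.normSq_apply]
  simp
  ring

lemma trace_cfc_mul_cfc {x y : Matrix m m ℂ} (hx : x.IsHermitian) (hy : y.IsHermitian)
    (f g : ℝ → ℝ) :
    (cfc f x * cfc g y).trace.re = ∑ i, ∑ j, ‖eigenOverlap hx hy i j‖ ^ 2 *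
      (f (hx.eigenvalues i) * g (hy.eigenvalues j)) := by
  rw [← trace_diagonal_sandwich, cfc_eq_conj_diagonal hx, cfc_eq_conj_diagonal hy, eigenOverlap]
  congr 1
  rw [trace_mul_comm]
  simp only [conjTranspose_mul, star_eq_conjTranspose, conjTranspose_conjTranspose, Matrix.mul_assoc]
  rw [trace_mul_comm]
  simp only [Matrix.mul_assoc]
  rw [trace_mul_comm]
  simp only [Matrix.mul_assoc]

lemma trace_eq_sum_overlap_left {x y : Matrix m m ℂ} (hx : x.IsHermitian) (hy : y.IsHermitian)
    (f : ℝ → ℝ) :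
    (cfc f x).trace.re = ∑ i, ∑ j, ‖eigenOverlap hx hy i j‖ ^ 2 * f (hx.eigenvalues i) := by
  have h := trace_cfc_mul_cfc hx hy f (fun _ => 1)
  rw [cfc_const_one ℝ y hy.isSelfAdjoint] at h
  simpa using h

lemma trace_eq_sum_overlap_right {x y : Matrix m m ℂ} (hx : x.IsHermitian) (hy : y.IsHermitian)
    (f : ℝ → ℝ) :
    (cfc f y).trace.re = ∑ i, ∑ j, ‖eigenOverlap hx hy i j‖ ^ 2 * f (hy.eigenvalues j) := by
  have h := trace_cfc_mul_cfc hx hy (fun _ => 1) f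
  rw [cfc_const_one ℝ x hx.isSelfAdjoint] at h
  simpa using h

lemma mul_cfc_log {x : Matrix m m ℂ} (hx : x.IsHermitian) :
    x * cfc Real.log x = cfc (fun t => t * Real.log t) x := by
  conv_lhs => enter [1]; rw [← cfc_id' ℝ x hx.isSelfAdjoint]
  rw [← cfc_mul _ _ x (finite_real_spectrum.continuousOn _)
    (finite_real_spectrum.continuousOn _)]

lemma relEntropy_eq_sum {x y : Matrix m m ℂ} (hx : x.IsHermitian) (hy : y.IsHermitian) :
    relEntropy x y = ∑ i, ∑ j, ‖eigenOverlap hx hy i j‖ ^ 2 *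
      (hx.eigenvalues i * Real.log (hx.eigenvalues i)
        - hx.eigenvalues i * Real.log (hy.eigenvalues j)
        - hx.eigenvalues i + hy.eigenvalues j) := by
  have h1 := trace_eq_sum_overlap_left hx hy (fun t => t * Real.log t)
  have h2 := trace_cfc_mul_cfc hx hy (fun t => t) Real.log
  have h3 := trace_eq_sum_overlap_left hx hy (fun t => t)
  have h4 := trace_eq_sum_overlap_right hx hy (fun t => t)
  rw [cfc_id' ℝ x hx.isSelfAdjoint] at h2 h3
  rw [cfc_id' ℝ y hy.isSelfAdjoint] at h4
  rw [relEntropy, mul_cfc_log hx, h1, h2, h3, h4]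
  simp_rw [← Finset.sum_sub_distrib, ← Finset.sum_add_distrib]
  refine Finset.sum_congr rfl fun i _ => Finset.sum_congr rfl fun j _ => ?_
  ring

lemma integral_quadratic_div {a b : ℝ} (ha : 0 < a) (hb : 0 < b) :
    IntervalIntegrable (fun s => (1 - s) * ((a - b) ^ 2 / (s * a + (1 - s) * b)))
      MeasureTheory.volume 0 1 ∧
    ∫ s in (0 : ℝ)..1, (1 - s) * ((a - b) ^ 2 / (s * a + (1 - s) * b)) =
      a * Real.log a - a * Real.log b - a + b := by
  have hpos : ∀ s ∈ [[(0 : ℝ), 1]], 0 < s * a + (1 - s) * b := by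
    intro s hs
    rw [Set.uIcc_of_le zero_le_one] at hs
    obtain ⟨h0, h1⟩ := hs
    rcases h0.eq_or_lt with rfl | h0
    · simpa using hb
    · nlinarith [mul_pos h0 ha, mul_nonneg (sub_nonneg.2 h1) hb.le]
  have hint : IntervalIntegrable (fun s => (1 - s) * ((a - b) ^ 2 / (s * a + (1 - s) * b)))
      MeasureTheory.volume 0 1 := by
    apply ContinuousOn.intervalIntegrable
    apply ContinuousOn.mul (by fun_prop)
    apply ContinuousOn.div (by fun_prop) (by fun_prop)
    exact fun s hs => (hpos s hs).ne'
  refine ⟨hint, ?_⟩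
  rw [intervalIntegral.integral_eq_sub_of_hasDerivAt
    (f := fun s => a * Real.log (s * a + (1 - s) * b) - (s * a + (1 - s) * b)) ?_ hint]
  · simp
    ring
  · intro s hs
    have hd : HasDerivAt (fun s : ℝ => s * a + (1 - s) * b) (a - b) s := by
      refine (((hasDerivAt_id s).mul_const a).add
        (((hasDerivAt_const s (1 : ℝ)).sub (hasDerivAt_id s)).mul_const b)).congr_deriv ?_
      ring
    refine (((hd.log (hpos s hs).ne').const_mul a).sub hd).congr_deriv ?_
    have hne := (hpos s hs).ne'
    rw [← mul_div_assoc, ← mul_div_assoc, div_sub' hne, div_left_inj' hne]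
    ring

lemma relEntropy_eq_integral {x y : Matrix m m ℂ} (hx : x.PosDef) (hy : y.PosDef) :
    IntervalIntegrable (fun s => (1 - s) * relSup s hx.1 hy.1) MeasureTheory.volume 0 1 ∧
    ∫ s in (0 : ℝ)..1, (1 - s) * relSup s hx.1 hy.1 = relEntropy x y := by
  have key := fun i j => integral_quadratic_div (hx.eigenvalues_pos i) (hy.eigenvalues_pos j)
  have hfun : (fun s => (1 - s) * relSup s hx.1 hy.1) = fun s => ∑ i, ∑ j,
      ‖eigenOverlap hx.1 hy.1 i j‖ ^ 2 * ((1 - s) *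
        ((hx.1.eigenvalues i - hy.1.eigenvalues j) ^ 2 /
          (s * hx.1.eigenvalues i + (1 - s) * hy.1.eigenvalues j))) := by
    funext s
    simp_rw [relSup, Finset.mul_sum]
    refine Finset.sum_congr rfl fun i _ => Finset.sum_congr rfl fun j _ => ?_
    ring
  have hI : ∀ i j, IntervalIntegrable (fun s => ‖eigenOverlap hx.1 hy.1 i j‖ ^ 2 * ((1 - s) *
        ((hx.1.eigenvalues i - hy.1.eigenvalues j) ^ 2 /
          (s * hx.1.eigenvalues i + (1 - s) * hy.1.eigenvalues j))))
      MeasureTheory.volume 0 1 := fun i j => (key i j).1.const_mul _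
  have hI' : ∀ i, IntervalIntegrable (fun s => ∑ j, ‖eigenOverlap hx.1 hy.1 i j‖ ^ 2 * ((1 - s) *
        ((hx.1.eigenvalues i - hy.1.eigenvalues j) ^ 2 /
          (s * hx.1.eigenvalues i + (1 - s) * hy.1.eigenvalues j))))
      MeasureTheory.volume 0 1 := fun i => by
    simpa only [Finset.sum_fn] using IntervalIntegrable.sum Finset.univ fun j _ => hI i j
  rw [hfun]
  constructor
  · simpa only [Finset.sum_fn] using IntervalIntegrable.sum Finset.univ fun i _ => hI' i
  · rw [intervalIntegral.integral_finsetSum fun i _ => hI' i, relEntropy_eq_sum hx.1 hy.1]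
    refine Finset.sum_congr rfl fun i _ => ?_
    rw [intervalIntegral.integral_finsetSum fun j _ => hI i j]
    refine Finset.sum_congr rfl fun j _ => ?_
    rw [intervalIntegral.integral_const_mul, (key i j).2]

lemma relObjective_eq_sum (s : ℝ) {x y : Matrix m m ℂ} (hx : x.IsHermitian)
    (hy : y.IsHermitian) (M : Matrix m m ℂ) :
    relObjective s x y ((hx.eigenvectorUnitary : Matrix m m ℂ) * M *
        star (hy.eigenvectorUnitary : Matrix m m ℂ)) =
      ∑ i, ∑ j, (2 * (hx.eigenvalues i - hy.eigenvalues j) *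
          (star (M i j) * eigenOverlap hx hy i j).re
        - (s * hx.eigenvalues i + (1 - s) * hy.eigenvalues j) * ‖M i j‖ ^ 2) := by
  set U := (hx.eigenvectorUnitary : Matrix m m ℂ) with hU
  set V := (hy.eigenvectorUnitary : Matrix m m ℂ) with hV
  have hUU : Uᴴ * U = 1 := Unitary.coe_star_mul_self hx.eigenvectorUnitary
  have hVV : Vᴴ * V = 1 := Unitary.coe_star_mul_self hy.eigenvectorUnitary
  set A := diagonal (fun i => (hx.eigenvalues i : ℂ)) with hA
  set B := diagonal (fun i => (hy.eigenvalues i : ℂ)) with hB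
  have hxe : x = U * A * Uᴴ := eq_conj_diagonal hx
  have hye : y = V * B * Vᴴ := eq_conj_diagonal hy
  have hWe : eigenOverlap hx hy = Uᴴ * V := rfl
  have cU : ∀ Z : Matrix m m ℂ, Uᴴ * (U * Z) = Z := fun Z => by
    rw [← Matrix.mul_assoc, hUU, Matrix.one_mul]
  have cV : ∀ Z : Matrix m m ℂ, Vᴴ * (V * Z) = Z := fun Z => by
    rw [← Matrix.mul_assoc, hVV, Matrix.one_mul]
  have h1 : ((U * M * star V)ᴴ * (x - y)).trace = (Mᴴ * (A * (Uᴴ * V) - Uᴴ * V * B)).trace := by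
    rw [hxe, hye]
    simp only [star_eq_conjTranspose, conjTranspose_mul, conjTranspose_conjTranspose,
      Matrix.mul_sub, Matrix.mul_assoc, trace_sub, cU]
    congr 1 <;> rw [trace_mul_comm V] <;> simp only [Matrix.mul_assoc, hVV, Matrix.mul_one]
  have h2 : ((U * M * star V)ᴴ * x * (U * M * star V)).trace = (Mᴴ * (A * M)).trace := by
    rw [hxe]
    simp only [star_eq_conjTranspose, conjTranspose_mul, conjTranspose_conjTranspose,
      Matrix.mul_assoc, cU]
    rw [trace_mul_comm V]; simp only [Matrix.mul_assoc, hVV, Matrix.mul_one]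
  have h3 : ((U * M * star V)ᴴ * (U * M * star V) * y).trace = (Mᴴ * (M * B)).trace := by
    rw [hye]
    simp only [star_eq_conjTranspose, conjTranspose_mul, conjTranspose_conjTranspose,
      Matrix.mul_assoc, cU, cV]
    rw [trace_mul_comm V]; simp only [Matrix.mul_assoc, hVV, Matrix.mul_one]
  have h2' : (Mᴴ * (A * M)).trace.re = ∑ i, ∑ j, ‖M i j‖ ^ 2 * hx.eigenvalues i := by
    have := trace_diagonal_sandwich hx.eigenvalues (fun _ => 1) M
    simpa [← hA] using this
  have h3' : (Mᴴ * (M * B)).trace.re = ∑ i, ∑ j, ‖M i j‖ ^ 2 * hy.eigenvalues j := by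
    have := trace_diagonal_sandwich (fun _ => 1) hy.eigenvalues M
    simpa [← hB] using this
  have h1' : (Mᴴ * (A * (Uᴴ * V) - Uᴴ * V * B)).trace.re = ∑ i, ∑ j,
      (hx.eigenvalues i - hy.eigenvalues j) * (star (M i j) * eigenOverlap hx hy i j).re := by
    rw [← hWe, trace, Finset.sum_congr rfl fun j _ => diag_apply _ j]
    simp_rw [mul_apply (M := Mᴴ), Matrix.sub_apply, hA, hB, mul_diagonal, diagonal_mul,
      conjTranspose_apply]
    rw [Finset.sum_comm, Complex.re_sum]
    refine Finset.sum_congr rfl fun i _ => ?_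
    rw [Complex.re_sum]
    refine Finset.sum_congr rfl fun j _ => ?_
    simp
    ring
  rw [relObjective, h1, h2, h3, h1', h2', h3']
  simp_rw [Finset.mul_sum, ← Finset.sum_sub_distrib]
  refine Finset.sum_congr rfl fun i _ => Finset.sum_congr rfl fun j _ => ?_
  ring

lemma interpolated_eigenvalue_pos {x y : Matrix m m ℂ} (hx : x.PosDef) (hy : y.PosDef) {s : ℝ}
    (h0 : 0 ≤ s) (h1 : s ≤ 1) (i j : m) :
    0 < s * hx.1.eigenvalues i + (1 - s) * hy.1.eigenvalues j := by
  have ha := hx.eigenvalues_pos i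
  have hb := hy.eigenvalues_pos j
  rcases h0.eq_or_lt with rfl | h0
  · simpa using hb
  · nlinarith [mul_pos h0 ha, mul_nonneg (sub_nonneg.2 h1) hb.le]

lemma relObjective_le_relSup {x y : Matrix m m ℂ} (hx : x.PosDef) (hy : y.PosDef) {s : ℝ}
    (h0 : 0 ≤ s) (h1 : s ≤ 1) (X : Matrix m m ℂ) :
    relObjective s x y X ≤ relSup s hx.1 hy.1 := by
  set U := (hx.1.eigenvectorUnitary : Matrix m m ℂ) with hU
  set V := (hy.1.eigenvectorUnitary : Matrix m m ℂ) with hV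
  have hUU : U * star U = 1 := Unitary.coe_mul_star_self hx.1.eigenvectorUnitary
  have hVV : V * star V = 1 := Unitary.coe_mul_star_self hy.1.eigenvectorUnitary
  have hX : X = U * (star U * X * V) * star V := by
    have : U * (star U * X * V) * star V = (U * star U) * X * (V * star V) := by
      simp only [Matrix.mul_assoc]
    rw [this, hUU, hVV, Matrix.one_mul, Matrix.mul_one]
  rw [hX, relObjective_eq_sum, relSup]
  refine Finset.sum_le_sum fun i _ => Finset.sum_le_sum fun j _ => ?_
  have hc := interpolated_eigenvalue_pos hx hy h0 h1 i j
  generalize (star U * X * V) i j = z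
  generalize eigenOverlap hx.1 hy.1 i j = w
  generalize hx.1.eigenvalues i - hy.1.eigenvalues j = d
  generalize s * hx.1.eigenvalues i + (1 - s) * hy.1.eigenvalues j = c at hc
  rw [← Complex.normSq_eq_norm_sq, ← Complex.normSq_eq_norm_sq, Complex.normSq_apply,
    Complex.normSq_apply, ← mul_div_assoc, le_div_iff₀ hc]
  simp
  nlinarith [sq_nonneg (c * z.re - d * w.re), sq_nonneg (c * z.im - d * w.im)]

lemma exists_relObjective_eq_relSup {x y : Matrix m m ℂ} (hx : x.PosDef) (hy : y.PosDef) {s : ℝ}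
    (h0 : 0 ≤ s) (h1 : s ≤ 1) :
    ∃ X, relObjective s x y X = relSup s hx.1 hy.1 := by
  refine ⟨_, (relObjective_eq_sum s hx.1 hy.1 (of fun i j =>
    (((hx.1.eigenvalues i - hy.1.eigenvalues j) /
      (s * hx.1.eigenvalues i + (1 - s) * hy.1.eigenvalues j) : ℝ) : ℂ) *
        eigenOverlap hx.1 hy.1 i j)).trans ?_⟩
  rw [relSup]
  refine Finset.sum_congr rfl fun i _ => Finset.sum_congr rfl fun j _ => ?_
  have hc := interpolated_eigenvalue_pos hx hy h0 h1 i j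
  rw [of_apply]
  generalize eigenOverlap hx.1 hy.1 i j = w
  generalize hx.1.eigenvalues i - hy.1.eigenvalues j = d
  generalize s * hx.1.eigenvalues i + (1 - s) * hy.1.eigenvalues j = c at hc
  have hr : (star (((d / c : ℝ) : ℂ) * w) * w).re = d / c * ‖w‖ ^ 2 := by
    rw [← Complex.normSq_eq_norm_sq, Complex.normSq_apply, star_mul', Complex.star_def,
      Complex.conj_ofReal, mul_assoc, Complex.re_ofReal_mul, Complex.mul_re,
      Complex.conj_re, Complex.conj_im]
    ring
  rw [hr, norm_mul, Complex.norm_real, mul_pow, Real.norm_eq_abs, sq_abs]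
  field_simp
  ring

/-- If the variational functional of `(x', y')` is bounded by `c` times every upper bound of the
variational functional of `(x, y)`, then so is the relative entropy. -/
lemma relEntropy_le_mul {x y x' y' : Matrix m m ℂ} (hx : x.PosDef) (hy : y.PosDef)
    (hx' : x'.PosDef) (hy' : y'.PosDef) (c : ℝ)
    (h : ∀ s, 0 ≤ s → s ≤ 1 → ∀ B, (∀ X, relObjective s x y X ≤ B) →
      ∀ X, relObjective s x' y' X ≤ c * B) :
    relEntropy x' y' ≤ c * relEntropy x y := by
  obtain ⟨hi, he⟩ := relEntropy_eq_integral hx hy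
  obtain ⟨hi', he'⟩ := relEntropy_eq_integral hx' hy'
  rw [← he, ← he', ← intervalIntegral.integral_const_mul]
  refine intervalIntegral.integral_mono_on zero_le_one hi' (hi.const_mul c) fun s hs => ?_
  obtain ⟨X, hX⟩ := exists_relObjective_eq_relSup hx' hy' hs.1 hs.2
  have := h s hs.1 hs.2 _ (relObjective_le_relSup hx hy hs.1 hs.2) X
  rw [hX] at this
  nlinarith [mul_le_mul_of_nonneg_left this (sub_nonneg.2 hs.2)]

end RelativeEntropy

section Qubits

lemma relObjective_add {m : Type*} [Fintype m] (s : ℝ)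
    (x y x' y' X : Matrix m m ℂ) :
    relObjective s (x + x') (y + y') X = relObjective s x y X + relObjective s x' y' X := by
  simp only [relObjective, Matrix.mul_add, Matrix.add_mul, Matrix.mul_sub, trace_add, trace_sub,
    Complex.add_re, Complex.sub_re]
  ring

lemma relObjective_smul {m : Type*} [Fintype m] (s c : ℝ)
    (x y X : Matrix m m ℂ) :
    relObjective s ((c : ℂ) • x) ((c : ℂ) • y) X = c * relObjective s x y X := by
  simp only [relObjective, Matrix.mul_smul, Matrix.smul_mul, Matrix.mul_sub, trace_smul,
    trace_sub, smul_eq_mul, Complex.sub_re, Complex.re_ofReal_mul]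
  ring

/-- The variational functional is covariant under conjugation by a Hermitian unitary. -/
lemma relObjective_conj {m : Type*} [Fintype m] [DecidableEq m] (s : ℝ)
    {H : Matrix m m ℂ} (hH : Hᴴ = H) (hHH : H * H = 1) (x y X : Matrix m m ℂ) :
    relObjective s (H * x * H) (H * y * H) X = relObjective s x y (H * X * H) := by
  have c : ∀ Z : Matrix m m ℂ, H * (H * Z) = Z := fun Z => by
    rw [← Matrix.mul_assoc, hHH, Matrix.one_mul]
  have t : ∀ Z : Matrix m m ℂ, (H * Z).trace = (Z * H).trace := fun Z => trace_mul_comm _ _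
  simp only [relObjective, conjTranspose_mul, hH, Matrix.mul_sub, trace_sub, Matrix.mul_assoc, c, t,
    hHH, Matrix.mul_one]

variable {n : ℕ}

/-- Flip bit `i`. -/
def flipBit (i : Fin n) (f : Fin n → Bool) : Fin n → Bool :=
  Function.update f i (!f i)

/-- The Pauli `Z` operator on qubit `i`. -/
def pauliZ (i : Fin n) : Matrix (Fin n → Bool) (Fin n → Bool) ℂ :=
  diagonal fun f => if f i then -1 else 1

/-- The Pauli `X` operator on qubit `i`. -/
def pauliX (i : Fin n) : Matrix (Fin n → Bool) (Fin n → Bool) ℂ :=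
  of fun f g => if flipBit i f = g then 1 else 0

lemma flipBit_flipBit (i : Fin n) (f : Fin n → Bool) : flipBit i (flipBit i f) = f := by
  simp [flipBit]

lemma pauliX_mul_apply (i : Fin n) (M : Matrix (Fin n → Bool) (Fin n → Bool) ℂ)
    (f g : Fin n → Bool) : (pauliX i * M) f g = M (flipBit i f) g := by
  simp [pauliX, mul_apply]

lemma flipBit_eq_iff (i : Fin n) (f g : Fin n → Bool) : flipBit i f = g ↔ f = flipBit i g :=
  ⟨fun h => by rw [← h, flipBit_flipBit], fun h => by rw [h, flipBit_flipBit]⟩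

lemma mul_pauliX_apply (i : Fin n) (M : Matrix (Fin n → Bool) (Fin n → Bool) ℂ)
    (f g : Fin n → Bool) : (M * pauliX i) f g = M f (flipBit i g) := by
  simp [pauliX, mul_apply, flipBit_eq_iff]

lemma pauliX_isHermitian (i : Fin n) : (pauliX i)ᴴ = pauliX i := by
  ext f g
  simp [pauliX, conjTranspose_apply, flipBit_eq_iff, eq_comm (a := f)]

lemma pauliX_mul_self (i : Fin n) : pauliX i * pauliX i = 1 := by
  ext f g
  rw [pauliX_mul_apply]
  simp [pauliX, flipBit_flipBit, one_apply]

lemma pauliZ_isHermitian (i : Fin n) : (pauliZ i)ᴴ = pauliZ i := by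
  rw [pauliZ, diagonal_conjTranspose]
  congr 1
  funext f
  cases h : f i <;> simp [h]

lemma pauliZ_mul_self (i : Fin n) : pauliZ i * pauliZ i = 1 := by
  rw [pauliZ, diagonal_mul_diagonal, ← diagonal_one]
  congr 1
  funext f
  split_ifs <;> simp

lemma pauliZ_conj_apply (i : Fin n) (M : Matrix (Fin n → Bool) (Fin n → Bool) ℂ)
    (f g : Fin n → Bool) :
    (pauliZ i * M * pauliZ i) f g = if f i = g i then M f g else -M f g := by
  rw [pauliZ, mul_diagonal, diagonal_mul]
  cases f i <;> cases g i <;> simp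

/-- Replacing a qubit by the maximally mixed state is the uniform Pauli twirl. -/
lemma replaceQubit_eq (i : Fin n) (x : Matrix (Fin n → Bool) (Fin n → Bool) ℂ) :
    replaceQubit i x = ((1 / 4 : ℝ) : ℂ) • (x + pauliZ i * x * pauliZ i + pauliX i * x * pauliX i +
      pauliX i * (pauliZ i * x * pauliZ i) * pauliX i) := by
  ext f g
  simp only [replaceQubit, of_apply, Matrix.smul_apply, Matrix.add_apply, mul_pauliX_apply,
    pauliX_mul_apply, pauliZ_conj_apply]
  have hf : Function.update f i (f i) = f := Function.update_eq_self i f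
  have hg : Function.update g i (g i) = g := Function.update_eq_self i g
  simp only [flipBit, Function.update_self]
  cases hfi : f i <;> cases hgi : g i <;> rw [hfi] at hf <;> rw [hgi] at hg <;>
    simp [hf, hg] <;> ring

lemma replaceQubit_eq_self {i : Fin n} {y : Matrix (Fin n → Bool) (Fin n → Bool) ℂ}
    (hX : Commute y (pauliX i)) (hZ : Commute y (pauliZ i)) : replaceQubit i y = y := by
  have h1 : pauliZ i * y * pauliZ i = y := by
    rw [← hZ.eq, Matrix.mul_assoc, pauliZ_mul_self, Matrix.mul_one]
  have h2 : pauliX i * y * pauliX i = y := by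
    rw [← hX.eq, Matrix.mul_assoc, pauliX_mul_self, Matrix.mul_one]
  rw [replaceQubit_eq, h1, h2]
  ext f g
  simp
  ring

lemma replaceQubit_add (i : Fin n) (x y : Matrix (Fin n → Bool) (Fin n → Bool) ℂ) :
    replaceQubit i (x + y) = replaceQubit i x + replaceQubit i y := by
  simp only [replaceQubit_eq, Matrix.mul_add, Matrix.add_mul, ← smul_add]
  congr 1
  abel

lemma replaceQubit_smul (i : Fin n) (c : ℂ) (x : Matrix (Fin n → Bool) (Fin n → Bool) ℂ) :
    replaceQubit i (c • x) = c • replaceQubit i x := by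
  simp only [replaceQubit_eq, Matrix.mul_smul, Matrix.smul_mul, ← smul_add]
  rw [smul_comm]

lemma replaceQubit_one (i : Fin n) :
    replaceQubit i (1 : Matrix (Fin n → Bool) (Fin n → Bool) ℂ) = 1 :=
  replaceQubit_eq_self (Commute.one_left _) (Commute.one_left _)

lemma replaceQubit_idem (i : Fin n) (x : Matrix (Fin n → Bool) (Fin n → Bool) ℂ) :
    replaceQubit i (replaceQubit i x) = replaceQubit i x := by
  ext f g
  by_cases h : f i = g i <;> simp [replaceQubit, h]

lemma replaceQubit_comm (i j : Fin n) (x : Matrix (Fin n → Bool) (Fin n → Bool) ℂ) :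
    replaceQubit i (replaceQubit j x) = replaceQubit j (replaceQubit i x) := by
  rcases eq_or_ne i j with rfl | hij
  · rfl
  ext f g
  by_cases hi : f i = g i <;> by_cases hj : f j = g j <;>
    simp [replaceQubit, hi, hj, hij, hij.symm, Function.update_comm hij]
  ring

lemma commute_pauliZ_of_replaceQubit_eq {i : Fin n} {y : Matrix (Fin n → Bool) (Fin n → Bool) ℂ}
    (h : replaceQubit i y = y) : Commute y (pauliZ i) := by
  have hc : pauliZ i * y * pauliZ i = y := by
    ext f g
    rw [pauliZ_conj_apply]
    split_ifs with hfg
    · rfl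
    · rw [← h]
      simp [replaceQubit, hfg]
  have := congrArg (pauliZ i * ·) hc
  simp only [← Matrix.mul_assoc, pauliZ_mul_self, Matrix.one_mul] at this
  exact this

lemma apply_flipBit_of_replaceQubit_eq {i : Fin n} {y : Matrix (Fin n → Bool) (Fin n → Bool) ℂ}
    (h : replaceQubit i y = y) (f g : Fin n → Bool) :
    y (flipBit i f) (flipBit i g) = y f g := by
  rw [← h]
  simp [replaceQubit, flipBit]

lemma commute_pauliX_of_replaceQubit_eq {i : Fin n} {y : Matrix (Fin n → Bool) (Fin n → Bool) ℂ}
    (h : replaceQubit i y = y) : Commute y (pauliX i) := by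
  ext f g
  rw [pauliX_mul_apply, mul_pauliX_apply, ← apply_flipBit_of_replaceQubit_eq h, flipBit_flipBit]

lemma replaceQubit_cfc {i : Fin n} {y : Matrix (Fin n → Bool) (Fin n → Bool) ℂ}
    (h : replaceQubit i y = y) (f : ℝ → ℝ) : replaceQubit i (cfc f y) = cfc f y :=
  replaceQubit_eq_self ((commute_pauliX_of_replaceQubit_eq h).cfc_real f)
    ((commute_pauliZ_of_replaceQubit_eq h).cfc_real f)

lemma trace_replaceQubit_mul (i : Fin n) (x y : Matrix (Fin n → Bool) (Fin n → Bool) ℂ) :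
    (replaceQubit i x * y).trace = (x * replaceQubit i y).trace := by
  have t : ∀ H x y : Matrix (Fin n → Bool) (Fin n → Bool) ℂ,
      (H * x * H * y).trace = (x * (H * y * H)).trace := fun H x y => by
    rw [Matrix.mul_assoc, Matrix.mul_assoc, trace_mul_comm]
    simp only [Matrix.mul_assoc]
  have u : pauliX i * (pauliZ i * y * pauliZ i) * pauliX i =
      pauliZ i * (pauliX i * y * pauliX i) * pauliZ i := by
    ext f g
    simp only [pauliZ_conj_apply, mul_pauliX_apply, pauliX_mul_apply]
    simp [flipBit]
  simp only [replaceQubit_eq, Matrix.smul_mul, Matrix.mul_smul, trace_smul, Matrix.add_mul,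
    Matrix.mul_add, trace_add, t, u]

lemma posDef_conj {m : Type*} [Fintype m] [DecidableEq m] {H x : Matrix m m ℂ} (hH : Hᴴ = H)
    (hHH : H * H = 1) (hx : x.PosDef) : (H * x * H).PosDef := by
  have h : Function.Injective H.mulVec := mulVec_injective_of_isUnit
    (IsUnit.of_mul_eq_one H hHH)
  have := hx.conjTranspose_mul_mul_same h
  rwa [hH] at this

lemma posDef_replaceQubit (i : Fin n) {x : Matrix (Fin n → Bool) (Fin n → Bool) ℂ}
    (hx : x.PosDef) : (replaceQubit i x).PosDef := by
  have hz := posDef_conj (pauliZ_isHermitian i) (pauliZ_mul_self i) hx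
  have hX := posDef_conj (pauliX_isHermitian i) (pauliX_mul_self i) hx
  have hXz := posDef_conj (pauliX_isHermitian i) (pauliX_mul_self i) hz
  rw [replaceQubit_eq]
  exact (((hx.add hz).add hX).add hXz).smul (Complex.zero_lt_real.2 (by norm_num))

/-- Replacing a qubit by the maximally mixed state does not increase upper bounds of the
variational functional. -/
lemma relObjective_replaceQubit_le (i : Fin n) {s B : ℝ}
    {x y : Matrix (Fin n → Bool) (Fin n → Bool) ℂ} (h : ∀ X, relObjective s x y X ≤ B)
    (X : Matrix (Fin n → Bool) (Fin n → Bool) ℂ) :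
    relObjective s (replaceQubit i x) (replaceQubit i y) X ≤ B := by
  rw [replaceQubit_eq, replaceQubit_eq, relObjective_smul, relObjective_add, relObjective_add,
    relObjective_add, relObjective_conj s (pauliX_isHermitian i) (pauliX_mul_self i),
    relObjective_conj s (pauliX_isHermitian i) (pauliX_mul_self i),
    relObjective_conj s (pauliZ_isHermitian i) (pauliZ_mul_self i),
    relObjective_conj s (pauliZ_isHermitian i) (pauliZ_mul_self i)]
  linarith [h X, h (pauliZ i * X * pauliZ i), h (pauliX i * X * pauliX i),
    h (pauliZ i * (pauliX i * X * pauliX i) * pauliZ i)]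

/-- With probability `p`, replace qubit `i` by the maximally mixed state. -/
noncomputable def depolarizeQubit (p : ℝ) (i : Fin n)
    (x : Matrix (Fin n → Bool) (Fin n → Bool) ℂ) : Matrix (Fin n → Bool) (Fin n → Bool) ℂ :=
  ((1 - p : ℝ) : ℂ) • x + ((p : ℝ) : ℂ) • replaceQubit i x

/-- Apply `depolarizeQubit` to every qubit of a list. -/
noncomputable def depolarizeList (p : ℝ) (L : List (Fin n))
    (x : Matrix (Fin n → Bool) (Fin n → Bool) ℂ) : Matrix (Fin n → Bool) (Fin n → Bool) ℂ :=
  L.foldr (depolarizeQubit p) x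

/-- Replace every qubit of a list by the maximally mixed state. -/
noncomputable def replaceList (L : List (Fin n))
    (x : Matrix (Fin n → Bool) (Fin n → Bool) ℂ) : Matrix (Fin n → Bool) (Fin n → Bool) ℂ :=
  L.foldr replaceQubit x

lemma replaceQubit_depolarizeQubit (p : ℝ) (i j : Fin n)
    (x : Matrix (Fin n → Bool) (Fin n → Bool) ℂ) :
    replaceQubit i (depolarizeQubit p j x) = depolarizeQubit p j (replaceQubit i x) := by
  rw [depolarizeQubit, depolarizeQubit, replaceQubit_add, replaceQubit_smul, replaceQubit_smul,
    replaceQubit_comm]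

lemma depolarizeQubit_eq_self {p : ℝ} {i : Fin n} {x : Matrix (Fin n → Bool) (Fin n → Bool) ℂ}
    (h : replaceQubit i x = x) : depolarizeQubit p i x = x := by
  rw [depolarizeQubit, h, ← add_smul]
  simp

lemma replaceList_depolarizeQubit (p : ℝ) (L : List (Fin n)) (i : Fin n)
    (x : Matrix (Fin n → Bool) (Fin n → Bool) ℂ) :
    replaceList L (depolarizeQubit p i x) = depolarizeQubit p i (replaceList L x) := by
  induction L with
  | nil => rfl
  | cons j L ih =>
    simp only [replaceList, List.foldr_cons] at ih ⊢
    rw [ih, replaceQubit_depolarizeQubit]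

lemma replaceList_depolarizeList (p : ℝ) (L : List (Fin n))
    (x : Matrix (Fin n → Bool) (Fin n → Bool) ℂ) :
    replaceList L (depolarizeList p L x) = replaceList L x := by
  induction L with
  | nil => rfl
  | cons i L ih =>
    change replaceQubit i (replaceList L (depolarizeQubit p i (depolarizeList p L x))) =
      replaceQubit i (replaceList L x)
    rw [replaceList_depolarizeQubit, ih, replaceQubit_depolarizeQubit,
      depolarizeQubit_eq_self (replaceQubit_idem i _)]

lemma replaceQubit_replaceList {L : List (Fin n)} {j : Fin n} (hj : j ∈ L)
    (x : Matrix (Fin n → Bool) (Fin n → Bool) ℂ) :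
    replaceQubit j (replaceList L x) = replaceList L x := by
  induction L with
  | nil => simp at hj
  | cons i L ih =>
    change replaceQubit j (replaceQubit i (replaceList L x)) = replaceQubit i (replaceList L x)
    rcases List.mem_cons.1 hj with rfl | hj
    · exact replaceQubit_idem _ _
    · rw [replaceQubit_comm, ih hj]

lemma trace_replaceList_mul (L : List (Fin n)) (x : Matrix (Fin n → Bool) (Fin n → Bool) ℂ)
    {y : Matrix (Fin n → Bool) (Fin n → Bool) ℂ} (hy : ∀ j ∈ L, replaceQubit j y = y) :
    (replaceList L x * y).trace = (x * y).trace := by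
  induction L with
  | nil => rfl
  | cons i L ih =>
    change (replaceQubit i (replaceList L x) * y).trace = _
    rw [trace_replaceQubit_mul, hy i (by simp), ih fun j hj => hy j (by simp [hj])]

lemma trace_replaceList (L : List (Fin n)) (x : Matrix (Fin n → Bool) (Fin n → Bool) ℂ) :
    (replaceList L x).trace = x.trace := by
  have := trace_replaceList_mul L x (y := 1) fun j _ => replaceQubit_one j
  rwa [Matrix.mul_one, Matrix.mul_one] at this

lemma posDef_replaceList (L : List (Fin n)) {x : Matrix (Fin n → Bool) (Fin n → Bool) ℂ}
    (hx : x.PosDef) : (replaceList L x).PosDef := by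
  induction L with
  | nil => exact hx
  | cons i L ih => exact posDef_replaceQubit i ih

lemma posDef_depolarizeQubit {p : ℝ} (hp0 : 0 ≤ p) (hp1 : p ≤ 1) (i : Fin n)
    {x : Matrix (Fin n → Bool) (Fin n → Bool) ℂ} (hx : x.PosDef) :
    (depolarizeQubit p i x).PosDef := by
  rw [depolarizeQubit]
  rcases hp0.eq_or_lt with rfl | hp0
  · simpa using hx
  · refine PosDef.posSemidef_add (hx.posSemidef.smul ?_) ((posDef_replaceQubit i hx).smul ?_)
    · exact Complex.zero_le_real.2 (sub_nonneg.2 hp1)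
    · exact Complex.zero_lt_real.2 hp0

lemma posDef_depolarizeList {p : ℝ} (hp0 : 0 ≤ p) (hp1 : p ≤ 1) (L : List (Fin n))
    {x : Matrix (Fin n → Bool) (Fin n → Bool) ℂ} (hx : x.PosDef) :
    (depolarizeList p L x).PosDef := by
  induction L with
  | nil => exact hx
  | cons i L ih => exact posDef_depolarizeQubit hp0 hp1 i ih

lemma relEntropy_replaceList (L : List (Fin n)) (x : Matrix (Fin n → Bool) (Fin n → Bool) ℂ) :
    relEntropy x (replaceList L x) = negEntropy x - negEntropy (replaceList L x) := by
  rw [relEntropy, trace_replaceList, negEntropy, negEntropy, trace_replaceList_mul L x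
    fun j hj => replaceQubit_cfc (replaceQubit_replaceList hj x) _]
  ring

/-- Data processing for the depolarization of one qubit. -/
lemma relEntropy_depolarizeQubit_le {p : ℝ} (hp0 : 0 ≤ p) (hp1 : p ≤ 1) (i : Fin n)
    {x y : Matrix (Fin n → Bool) (Fin n → Bool) ℂ} (hx : x.PosDef) (hy : y.PosDef) :
    relEntropy (depolarizeQubit p i x) (depolarizeQubit p i y) ≤ relEntropy x y := by
  rw [← one_mul (relEntropy x y)]
  refine relEntropy_le_mul hx hy (posDef_depolarizeQubit hp0 hp1 i hx)
    (posDef_depolarizeQubit hp0 hp1 i hy) 1 fun s _ _ B hB X => ?_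
  rw [depolarizeQubit, depolarizeQubit, relObjective_add, relObjective_smul, relObjective_smul]
  nlinarith [mul_le_mul_of_nonneg_left (hB X) (sub_nonneg.2 hp1),
    mul_le_mul_of_nonneg_left (relObjective_replaceQubit_le i hB X) hp0]

lemma relObjective_self_nonpos {m : Type*} [Fintype m] [DecidableEq m] {s : ℝ} (h0 : 0 ≤ s)
    (h1 : s ≤ 1) {y : Matrix m m ℂ} (hy : y.PosDef) (X : Matrix m m ℂ) :
    relObjective s y y X ≤ 0 := by
  refine (relObjective_le_relSup hy hy h0 h1 X).trans (le_of_eq ?_)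
  have hW : eigenOverlap hy.1 hy.1 = 1 := Unitary.coe_star_mul_self hy.1.eigenvectorUnitary
  rw [relSup, hW]
  refine Finset.sum_eq_zero fun i _ => Finset.sum_eq_zero fun j _ => ?_
  rcases eq_or_ne i j with rfl | hij
  · simp
  · simp [one_apply, hij]

/-- Contraction towards the conditional expectation for the depolarization of one qubit. -/
lemma relEntropy_depolarizeQubit_replaceQubit_le {p : ℝ} (hp0 : 0 ≤ p) (hp1 : p ≤ 1) (i : Fin n)
    {x : Matrix (Fin n → Bool) (Fin n → Bool) ℂ} (hx : x.PosDef) :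
    relEntropy (depolarizeQubit p i x) (replaceQubit i x) ≤
      (1 - p) * relEntropy x (replaceQubit i x) := by
  have hy := posDef_replaceQubit i hx
  refine relEntropy_le_mul hx hy (posDef_depolarizeQubit hp0 hp1 i hx)
    hy (1 - p) fun s h0 h1 B hB X => ?_
  have hsplit : replaceQubit i x = depolarizeQubit p i (replaceQubit i x) :=
    (depolarizeQubit_eq_self (replaceQubit_idem i x)).symm
  rw [hsplit, depolarizeQubit, depolarizeQubit, relObjective_add, relObjective_smul,
    relObjective_smul, replaceQubit_idem]
  nlinarith [mul_le_mul_of_nonneg_left (hB X) (sub_nonneg.2 hp1),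
    mul_le_mul_of_nonneg_left (relObjective_self_nonpos h0 h1 hy X) hp0]

/-- Depolarizing the qubits of a list contracts the relative entropy to the state in which these
qubits are replaced by maximally mixed ones. -/
lemma negEntropy_depolarizeList_le {p : ℝ} (hp0 : 0 ≤ p) (hp1 : p ≤ 1) (L : List (Fin n))
    {x : Matrix (Fin n → Bool) (Fin n → Bool) ℂ} (hx : x.PosDef) :
    negEntropy (depolarizeList p L x) - negEntropy (replaceList L x) ≤
      (1 - p) * (negEntropy x - negEntropy (replaceList L x)) := by
  induction L with
  | nil =>
    change negEntropy x - negEntropy x ≤ (1 - p) * (negEntropy x - negEntropy x)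
    simp
  | cons i L ih =>
    change negEntropy (depolarizeQubit p i (depolarizeList p L x)) -
      negEntropy (replaceQubit i (replaceList L x)) ≤
        (1 - p) * (negEntropy x - negEntropy (replaceQubit i (replaceList L x)))
    have hR := posDef_replaceList L hx
    have h1 := relEntropy_depolarizeQubit_le hp0 hp1 i (posDef_depolarizeList hp0 hp1 L hx) hR
    have h2 := relEntropy_depolarizeQubit_replaceQubit_le hp0 hp1 i hR
    have e1 := relEntropy_replaceList L (depolarizeQubit p i (depolarizeList p L x))
    rw [replaceList_depolarizeQubit, replaceList_depolarizeList] at e1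
    have e2 := relEntropy_replaceList L (depolarizeList p L x)
    rw [replaceList_depolarizeList] at e2
    have e3 : relEntropy (depolarizeQubit p i (replaceList L x)) (replaceQubit i (replaceList L x))
        = negEntropy (depolarizeQubit p i (replaceList L x)) -
          negEntropy (replaceQubit i (replaceList L x)) := by
      have := relEntropy_replaceList [i] (depolarizeQubit p i (replaceList L x))
      simp only [replaceList, List.foldr_cons, List.foldr_nil] at this ⊢
      rwa [replaceQubit_depolarizeQubit, depolarizeQubit_eq_self (replaceQubit_idem i _)] at this
    have e4 : relEntropy (replaceList L x) (replaceQubit i (replaceList L x)) =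
        negEntropy (replaceList L x) - negEntropy (replaceQubit i (replaceList L x)) :=
      relEntropy_replaceList [i] (replaceList L x)
    rw [e1, e2] at h1
    rw [e3, e4] at h2
    linarith

lemma eq_smul_one_of_replaceQubit_eq {y : Matrix (Fin n → Bool) (Fin n → Bool) ℂ}
    (h : ∀ i, replaceQubit i y = y) :
    y = (y (fun _ => false) (fun _ => false)) • (1 : Matrix (Fin n → Bool) (Fin n → Bool) ℂ) := by
  have hdiag : ∀ S : Finset (Fin n), ∀ f : Fin n → Bool, (∀ i ∉ S, f i = false) →
      y f f = y (fun _ => false) (fun _ => false) := by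
    intro S
    induction S using Finset.induction with
    | empty =>
      intro f hf
      rw [show f = fun _ => false from funext fun i => hf i (by simp)]
    | insert i S hi ih =>
      intro f hf
      by_cases hfi : f i = false
      · refine ih f fun j hj => ?_
        rcases eq_or_ne j i with rfl | hji
        · exact hfi
        · exact hf j (by simp [hji, hj])
      · rw [← apply_flipBit_of_replaceQubit_eq (h i)]
        refine ih _ fun j hj => ?_
        rcases eq_or_ne j i with rfl | hji
        · simpa [flipBit] using hfi
        · rw [flipBit, Function.update_of_ne hji]
          exact hf j (by simp [hji, hj])
  ext f g
  rcases eq_or_ne f g with rfl | hfg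
  · simpa using hdiag Finset.univ f (by simp)
  · obtain ⟨i, hi⟩ := Function.ne_iff.1 hfg
    have : y f g = 0 := by
      rw [← h i]
      simp [replaceQubit, hi]
    simp [this, hfg]

lemma replaceList_finRange {x : Matrix (Fin n → Bool) (Fin n → Bool) ℂ} (hx : x.trace = 1) :
    replaceList (List.finRange n) x =
      ((((2 : ℝ) ^ n)⁻¹ : ℝ) : ℂ) • (1 : Matrix (Fin n → Bool) (Fin n → Bool) ℂ) := by
  have h := eq_smul_one_of_replaceQubit_eq fun i =>
    replaceQubit_replaceList (List.mem_finRange i) x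
  have ht := trace_replaceList (List.finRange n) x
  generalize replaceList (List.finRange n) x = y at h ht
  rw [h, trace_smul, trace_one, hx] at ht
  rw [h]
  congr 1
  rw [smul_eq_mul] at ht
  rw [eq_inv_of_mul_eq_one_left ht]
  simp

lemma trace_cfc_re {m : Type*} [Fintype m] [DecidableEq m] {x : Matrix m m ℂ}
    (hx : x.IsHermitian) (f : ℝ → ℝ) : (cfc f x).trace.re = ∑ i, f (hx.eigenvalues i) := by
  rw [cfc_eq_conj_diagonal hx, trace_mul_comm, ← Matrix.mul_assoc, Unitary.coe_star_mul_self,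
    Matrix.one_mul, trace_diagonal, Complex.re_sum]
  simp

lemma vnEntropy_eq {m : Type*} [Fintype m] [DecidableEq m] {x : Matrix m m ℂ}
    (hx : x.IsHermitian) : vnEntropy hx = -(negEntropy x / Real.log 2) := by
  have h : matLog2 hx = cfc (fun t => (Real.log 2)⁻¹ * Real.log t) x := by
    rw [cfc_eq_conj_diagonal hx, matLog2]
    simp_rw [Real.logb, div_eq_inv_mul]
  rw [vnEntropy, h, cfc_const_mul _ _ _ (finite_real_spectrum.continuousOn _), negEntropy,
    Matrix.mul_smul, trace_smul, Complex.neg_re, Complex.smul_re, smul_eq_mul, div_eq_inv_mul]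

lemma negEntropy_maximallyMixed :
    negEntropy (((((2 : ℝ) ^ n)⁻¹ : ℝ) : ℂ) • (1 : Matrix (Fin n → Bool) (Fin n → Bool) ℂ)) =
      -(n * Real.log 2) := by
  have h : ((((2 : ℝ) ^ n)⁻¹ : ℝ) : ℂ) • (1 : Matrix (Fin n → Bool) (Fin n → Bool) ℂ) =
      algebraMap ℝ _ ((2 : ℝ) ^ n)⁻¹ := by
    rw [Algebra.algebraMap_eq_smul_one]
    rfl
  rw [negEntropy, h, cfc_algebraMap, ← map_mul, Algebra.algebraMap_eq_smul_one, trace_smul,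
    trace_one, Complex.smul_re, Real.log_inv, Real.log_pow]
  simp only [Fintype.card_pi, Fintype.card_bool, Finset.prod_const, Finset.card_univ,
    Fintype.card_fin, Complex.natCast_re, smul_eq_mul]
  push_cast
  field_simp

/-- The mixture of `x` with the multiple `c` of the identity. -/
noncomputable def mixIdentity {m : Type*} [DecidableEq m] (c ε : ℝ)
    (x : Matrix m m ℂ) : Matrix m m ℂ :=
  ((1 - ε : ℝ) : ℂ) • x + ((ε * c : ℝ) : ℂ) • 1

lemma negEntropy_mixIdentity {m : Type*} [Fintype m] [DecidableEq m] (c ε : ℝ)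
    {x : Matrix m m ℂ} (hx : x.IsHermitian) :
    negEntropy (mixIdentity c ε x) = ∑ i, ((1 - ε) * hx.eigenvalues i + ε * c) *
      Real.log ((1 - ε) * hx.eigenvalues i + ε * c) := by
  have h : mixIdentity c ε x = cfc (fun t => (1 - ε) * t + ε * c) x := by
    rw [cfc_add_const _ _ x (by fun_prop) hx.isSelfAdjoint, cfc_const_mul_id _ x hx.isSelfAdjoint,
      Algebra.algebraMap_eq_smul_one]
    rfl
  have hh : (mixIdentity c ε x).IsHermitian := by
    rw [h]
    exact cfc_predicate (R := ℝ) (p := IsSelfAdjoint) _ x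
  rw [negEntropy, mul_cfc_log hh, h, ← cfc_comp' _ _ x
    ((finite_real_spectrum.image _).continuousOn _) (by fun_prop) hx.isSelfAdjoint,
    trace_cfc_re hx]

lemma tendsto_negEntropy_mixIdentity {m : Type*} [Fintype m] [DecidableEq m] (c : ℝ)
    {x : Matrix m m ℂ} (hx : x.IsHermitian) :
    Filter.Tendsto (fun ε => negEntropy (mixIdentity c ε x)) (nhdsWithin 0 (Set.Ioi 0))
      (nhds (negEntropy x)) := by
  have h0 : negEntropy x = negEntropy (mixIdentity c 0 x) := by simp [mixIdentity]
  rw [h0]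
  simp_rw [negEntropy_mixIdentity c _ hx]
  refine (Continuous.tendsto ?_ 0).mono_left nhdsWithin_le_nhds
  refine continuous_finsetSum _ fun i _ => ?_
  exact Real.continuous_mul_log.comp (by fun_prop)

lemma depolarizeList_mixIdentity (p c ε : ℝ) (L : List (Fin n))
    (x : Matrix (Fin n → Bool) (Fin n → Bool) ℂ) :
    depolarizeList p L (mixIdentity c ε x) = mixIdentity c ε (depolarizeList p L x) := by
  induction L with
  | nil => rfl
  | cons i L ih =>
    change depolarizeQubit p i (depolarizeList p L (mixIdentity c ε x)) =
      mixIdentity c ε (depolarizeQubit p i (depolarizeList p L x))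
    rw [ih]
    simp only [mixIdentity, depolarizeQubit, replaceQubit_add, replaceQubit_smul, replaceQubit_one]
    push_cast
    module

/-- For a state of trace one, depolarizing every qubit contracts the gap between its negative
entropy and that of the maximally mixed state. -/
lemma negEntropy_depolarizeList_finRange_le {p : ℝ} (hp0 : 0 ≤ p) (hp1 : p ≤ 1)
    {x : Matrix (Fin n → Bool) (Fin n → Bool) ℂ} (hx : IsDensityMatrix x)
    (hσ : (depolarizeList p (List.finRange n) x).IsHermitian) :
    negEntropy (depolarizeList p (List.finRange n) x) + n * Real.log 2 ≤
      (1 - p) * (negEntropy x + n * Real.log 2) := by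
  set c : ℝ := ((2 : ℝ) ^ n)⁻¹ with hc
  have hcpos : 0 < c := by positivity
  refine le_of_tendsto_of_tendsto
    ((tendsto_negEntropy_mixIdentity c hσ).add_const _)
    (((tendsto_negEntropy_mixIdentity c hx.1.1).add_const _).const_mul _) ?_
  filter_upwards [Ioo_mem_nhdsGT (zero_lt_one (α := ℝ))] with ε hε
  have hpd : (mixIdentity c ε x).PosDef := by
    refine PosDef.posSemidef_add (hx.1.smul ?_) (PosDef.one.smul ?_)
    · exact Complex.zero_le_real.2 (sub_nonneg.2 hε.2.le)
    · exact Complex.zero_lt_real.2 (mul_pos hε.1 hcpos)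
  have htr : (mixIdentity c ε x).trace = 1 := by
    rw [mixIdentity, trace_add, trace_smul, trace_smul, hx.2, trace_one, hc]
    simp
  have h := negEntropy_depolarizeList_le hp0 hp1 (List.finRange n) hpd
  rw [replaceList_finRange htr, negEntropy_maximallyMixed, depolarizeList_mixIdentity] at h
  linarith

end Qubits

/-- Quantum depolarizing noise contracts information: if `σ` is obtained from an `n`-qubit
density matrix `ρ` by independently replacing each qubit with probability `p` by the
maximally mixed state, then `I(σ) ≤ (1−p)·I(ρ)`, where `I(τ) = n − S(τ)` and `S` is the
von Neumann entropy in bits. -/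
theorem depolarize_info_decay {n : ℕ} (p : ℝ) (hp0 : 0 ≤ p) (hp1 : p ≤ 1)
    {ρ : Matrix (Fin n → Bool) (Fin n → Bool) ℂ} (hρ : IsDensityMatrix ρ)
    (hσ : (depolarize p ρ).IsHermitian) :
    (n : ℝ) - vnEntropy hσ ≤ (1 - p) * ((n : ℝ) - vnEntropy hρ.1.1) := by
  have h := negEntropy_depolarizeList_finRange_le hp0 hp1 hρ hσ
  have hlog : 0 < Real.log 2 := Real.log_pos one_lt_two
  rw [vnEntropy_eq, vnEntropy_eq, sub_neg_eq_add, sub_neg_eq_add]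
  refine le_of_mul_le_mul_right ?_ hlog
  have e : ∀ a : ℝ, ((n : ℝ) + a / Real.log 2) * Real.log 2 = a + n * Real.log 2 := fun a => by
    field_simp
    ring
  rw [mul_assoc, e, e]
  exact h
end
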